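/- Let n > 2k ≥ 10 and let F be an intersecting family of k-element subsets of [n]. If |F| > |J_3|, then there exist an element i ∈ [n] and a (k−1)-element set K ⊆ [n]∖{i} such that every member of F either contains i or contains K (equivalently, F ⊆ E_l for some l ∈ {0,…,k−1, n−k}). -/

import Mathlib

/-- A family is intersecting if any two of its members intersect. -/
def Intersecting (F : Finset (Finset ℕ)) : Prop :=
  ∀ A ∈ F, ∀ B ∈ F, (A ∩ B).Nonempty

/-- `I_i = [i+1, k+i]`. -/
def Iset (k i : ℕ) : Finset ℕ := Finset.Icc (i + 1) (k + i)

/-- The family `J_i = {I_1, I_i} ∪ {F ∈ C([n],k) : 1 ∈ F, F ∩ I_1 ≠ ∅, F ∩ I_i ≠ ∅}`. -/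
def Jfam (n k i : ℕ) : Finset (Finset ℕ) :=
  {Iset k 1, Iset k i} ∪
    (Finset.powersetCard k (Finset.Icc 1 n)).filter
      (fun A => 1 ∈ A ∧ (A ∩ Iset k 1).Nonempty ∧ (A ∩ Iset k i).Nonempty)

section
open Finset Finset.Colex
open scoped FinsetFamily

lemma hx_exists_initSeg (n r m : ℕ) (hm : m ≤ n.choose r) :
    ∃ C : Finset (Finset (Fin n)), IsInitSeg C r ∧ #C = m := by
  induction m with
  | zero => exact ⟨∅, isInitSeg_empty, rfl⟩
  | succ m ih =>
    obtain ⟨C, hC, hCm⟩ := ih (by omega)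
    have hsub : C ⊆ powersetCard r univ := fun X hX => by
      rw [mem_powersetCard]; exact ⟨subset_univ _, hC.1 hX⟩
    have hne : (powersetCard r univ \ C).Nonempty := by
      rw [← card_pos, card_sdiff_of_subset hsub, card_powersetCard, card_univ, Fintype.card_fin]
      omega
    obtain ⟨Z, hZ, hmin⟩ := exists_min_image _ (fun X => toColex X) hne
    rw [mem_sdiff, mem_powersetCard] at hZ
    refine ⟨insert Z C, ⟨?_, ?_⟩, by rw [card_insert_of_notMem hZ.2, hCm]⟩
    · intro X hX
      rw [mem_coe, mem_insert] at hX
      rcases hX with rfl | hX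
      · exact hZ.1.2
      · exact hC.1 hX
    · intro s t hs ht
      rw [mem_insert] at hs ⊢
      rcases hs with rfl | hs
      · right
        by_contra htC
        have := hmin t (by rw [mem_sdiff, mem_powersetCard]; exact ⟨⟨subset_univ _, ht.2⟩, htC⟩)
        exact absurd ht.1 (not_lt.2 this)
      · exact Or.inr (hC.2 hs ht)

/-- First `p` elements of `Fin n`. -/
def hxV (n p : ℕ) : Finset (Fin n) := univ.filter (fun x => x.val < p)

lemma hxV_card {n p : ℕ} (h : p ≤ n) : #(hxV n p) = p := by
  have : hxV n p = attachFin (range p) (fun m hm => by rw [mem_range] at hm; omega) := by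
    ext x; simp [hxV]
  rw [this, card_attachFin, card_range]

lemma hxV_initSeg (n p r : ℕ) : IsInitSeg (powersetCard r (hxV n p)) r := by
  refine ⟨Set.sized_powersetCard _ _, ?_⟩
  simp_rw [mem_powersetCard]
  rintro A B hA ⟨HB₁, HB₂⟩
  refine ⟨fun t ht ↦ ?_, ‹_›⟩
  have : toColex (image Fin.val B) < toColex (image Fin.val A) := by
    rwa [toColex_image_lt_toColex_image Fin.val_strictMono]
  simp only [hxV, mem_filter, mem_univ, true_and]
  apply Colex.forall_lt_mono this.le _ t (mem_image.2 ⟨t, ht, rfl⟩)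
  simp_rw [mem_image]
  rintro _ ⟨a, ha, hab⟩
  have := hA.1 ha
  simp only [hxV, mem_filter, mem_univ, true_and] at this
  omega

lemma hx_decomp {n p r s : ℕ} (hp : p + 1 ≤ n) (hrp : r ≤ p) (hsr : s ≤ r)
    (A : Finset (Finset (Fin n))) (hA : (A : Set (Finset (Fin n))).Sized r)
    (h1 : p.choose r ≤ #A) (h2 : #A ≤ (p + 1).choose r) :
    ∃ D : Finset (Finset (Fin n)), D ⊆ powersetCard (r - 1) (hxV n p) ∧
      #D + p.choose r = #A ∧ p.choose (r - s) + #(∂^[s] D) ≤ #(∂^[s] A) := by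
  classical
  have hAn : #A ≤ n.choose r := h2.trans (Nat.choose_le_choose _ hp)
  obtain ⟨C, hC, hCA⟩ := hx_exists_initSeg n r #A hAn
  have hkk : #(∂^[s] C) ≤ #(∂^[s] A) := iterated_kk hA hCA.le hC
  have hlow : powersetCard r (hxV n p) ⊆ C := by
    rcases (hxV_initSeg n p r).total hC with h | h
    · exact h
    · have := eq_of_subset_of_card_le h (by
        rw [card_powersetCard, hxV_card (by omega), hCA]; exact h1)
      rw [this]
  have hup : C ⊆ powersetCard r (hxV n (p+1)) := by
    rcases (hxV_initSeg n (p+1) r).total hC with h | h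
    · have := eq_of_subset_of_card_le h (by
        rw [card_powersetCard, hxV_card (by omega), hCA]; exact h2)
      rw [this]
    · exact h
  set pt : Fin n := ⟨p, hp⟩ with hpt
  have hVsub : ∀ X : Finset (Fin n), X ⊆ hxV n (p+1) → pt ∉ X → X ⊆ hxV n p := by
    intro X hX hpX x hx
    have h3 := hX hx
    simp only [hxV, mem_filter, mem_univ, true_and] at h3 ⊢
    have : x ≠ pt := fun h => hpX (h ▸ hx)
    have : x.val ≠ p := fun h => this (Fin.ext h)
    omega
  have hptV : pt ∉ hxV n p := by simp [hxV, hpt]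
  have hnot : C.filter (fun X => pt ∉ X) = powersetCard r (hxV n p) := by
    ext X
    rw [mem_filter]
    constructor
    · rintro ⟨h, h'⟩
      have := hup h
      rw [mem_powersetCard] at this ⊢
      exact ⟨hVsub X this.1 h', this.2⟩
    · intro h
      refine ⟨hlow h, fun h' => hptV ((mem_powersetCard.1 h).1 h')⟩
  refine ⟨(C.filter (fun X => pt ∈ X)).image (fun X => X.erase pt), ?_, ?_, le_trans ?_ hkk⟩
  · intro Y hY
    rw [mem_image] at hY
    obtain ⟨X, hX, rfl⟩ := hY
    rw [mem_filter] at hX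
    have := mem_powersetCard.1 (hup hX.1)
    rw [mem_powersetCard, card_erase_of_mem hX.2, this.2]
    exact ⟨hVsub _ ((erase_subset _ _).trans this.1) (notMem_erase _ _), rfl⟩
  · rw [card_image_of_injOn, ← hCA, ← card_filter_add_card_filter_not (s := C) (fun X => pt ∈ X),
      hnot, card_powersetCard, hxV_card (by omega)]
    intro X hX Y hY h
    simp only [coe_filter, Set.mem_setOf_eq] at hX hY
    have h : X.erase pt = Y.erase pt := h
    rw [← insert_erase hX.2, ← insert_erase hY.2, h]
  · set D := (C.filter (fun X => pt ∈ X)).image (fun X => X.erase pt) with hD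
    have hDpt : ∀ Y ∈ ∂^[s] D, pt ∉ Y := by
      intro Y hY h
      rw [mem_shadow_iterate_iff_exists_mem_card_add] at hY
      obtain ⟨Z, hZ, hYZ, -⟩ := hY
      rw [hD, mem_image] at hZ
      obtain ⟨X, hX, rfl⟩ := hZ
      exact notMem_erase _ _ (hYZ h)
    have hinj : #((∂^[s] D).image (fun Y => insert pt Y)) = #(∂^[s] D) := by
      apply card_image_of_injOn
      intro X hX Y hY h
      have h : insert pt X = insert pt Y := h
      rw [← erase_insert (hDpt X hX), ← erase_insert (hDpt Y hY), h]
    have hdisj : Disjoint (powersetCard (r - s) (hxV n p))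
        ((∂^[s] D).image (fun Y => insert pt Y)) := by
      rw [disjoint_left]
      intro X hX hX'
      rw [mem_image] at hX'
      obtain ⟨Y, hY, rfl⟩ := hX'
      exact hptV ((mem_powersetCard.1 hX).1 (mem_insert_self _ _))
    rw [← hinj]
    have : p.choose (r - s) = #(powersetCard (r - s) (hxV n p)) := by
      rw [card_powersetCard, hxV_card (by omega)]
    rw [this, ← card_union_of_disjoint hdisj]
    apply card_le_card
    apply union_subset
    · intro Y hY
      rw [mem_powersetCard] at hY
      obtain ⟨X, hYX, hXV, hXc⟩ := exists_subsuperset_card_eq hY.1 (n := r) (by omega)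
        (by rw [hxV_card (by omega)]; exact hrp)
      rw [mem_shadow_iterate_iff_exists_mem_card_add]
      exact ⟨X, hlow (mem_powersetCard.2 ⟨hXV, hXc⟩), hYX, by omega⟩
    · intro Y hY
      rw [mem_image] at hY
      obtain ⟨Z, hZ, rfl⟩ := hY
      have hZp := hDpt Z hZ
      rw [mem_shadow_iterate_iff_exists_mem_card_add] at hZ ⊢
      obtain ⟨W, hW, hZW, hc⟩ := hZ
      rw [hD, mem_image] at hW
      obtain ⟨X, hX, rfl⟩ := hW
      rw [mem_filter] at hX
      refine ⟨X, hX.1, ?_, ?_⟩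
      · intro z hz
        rw [mem_insert] at hz
        rcases hz with rfl | hz
        · exact hX.2
        · exact mem_of_mem_erase (hZW hz)
      · rw [card_insert_of_notMem hZp]
        rw [card_erase_of_mem hX.2] at hc
        have : 0 < #X := card_pos.2 ⟨_, hX.2⟩
        omega

/-- iterated local LYM inside a ground set `V`. -/
lemma hx_lym {α : Type*} [DecidableEq α] {V : Finset α} {r s : ℕ} (hsr : s ≤ r) (hr : r ≤ #V)
    (D : Finset (Finset α)) (hD : D ⊆ powersetCard r V) :
    #D * (#V).choose (r - s) ≤ #(∂^[s] D) * (#V).choose r := by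
  classical
  have h1 : #D * r.choose s ≤ #(∂^[s] D) * (#V - (r - s)).choose s := by
    apply card_mul_le_card_mul (fun X Y => Y ⊆ X)
    · intro X hX
      have hXc := (mem_powersetCard.1 (hD hX)).2
      have : powersetCard (r - s) X ⊆ (∂^[s] D).bipartiteAbove (fun X Y => Y ⊆ X) X := by
        intro Y hY
        rw [mem_powersetCard] at hY
        rw [mem_bipartiteAbove, mem_shadow_iterate_iff_exists_mem_card_add]
        exact ⟨⟨X, hX, hY.1, by omega⟩, hY.1⟩
      have h := card_le_card this
      rw [card_powersetCard, hXc, Nat.choose_symm hsr] at h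
      exact h
    · intro Y hY
      rw [mem_shadow_iterate_iff_exists_mem_card_add] at hY
      obtain ⟨X0, hX0, hYX0, hc0⟩ := hY
      have hX0c := mem_powersetCard.1 (hD hX0)
      have hYV : Y ⊆ V := hYX0.trans hX0c.1
      have hYc : #Y = r - s := by omega
      have hle : #(D.bipartiteBelow (fun X Y => Y ⊆ X) Y) ≤ #(powersetCard s (V \ Y)) := by
        apply card_le_card_of_injOn (fun X => X \ Y)
        · intro X hX
          rw [mem_coe, mem_bipartiteBelow] at hX
          have hXc := mem_powersetCard.1 (hD hX.1)
          rw [mem_coe, mem_powersetCard]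
          refine ⟨sdiff_subset_sdiff hXc.1 (le_refl _), ?_⟩
          rw [card_sdiff_of_subset hX.2]; omega
        · intro X hX X' hX' h
          rw [mem_coe, mem_bipartiteBelow] at hX hX'
          have h : X \ Y = X' \ Y := h
          rw [← sdiff_union_of_subset hX.2, ← sdiff_union_of_subset hX'.2, h]
      rw [card_powersetCard, card_sdiff_of_subset hYV, hYc] at hle
      exact hle
  have h2 : (#V).choose r * r.choose (r - s) = (#V).choose (r - s) * (#V - (r - s)).choose (r - (r - s)) :=
    Nat.choose_mul (by omega : r - s ≤ r)
  rw [Nat.choose_symm hsr, show r - (r - s) = s by omega] at h2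
  have hpos : 0 < r.choose s := Nat.choose_pos hsr
  apply Nat.le_of_mul_le_mul_right _ hpos
  calc #D * (#V).choose (r - s) * r.choose s = (#D * r.choose s) * (#V).choose (r - s) := by ring
    _ ≤ (#(∂^[s] D) * (#V - (r - s)).choose s) * (#V).choose (r - s) := Nat.mul_le_mul_right _ h1
    _ = #(∂^[s] D) * ((#V).choose (r - s) * (#V - (r - s)).choose s) := by ring
    _ = _ := by rw [← h2]; ring

/-- Lemma K. -/
lemma hx_K {n r s p0 P R : ℕ} (hr : 1 ≤ r) (hrp : r ≤ p0) (hsr : s ≤ r - 1) (hP : P ≤ n)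
    (hpP : p0 ≤ P)
    (A : Finset (Finset (Fin n))) (hA : (A : Set (Finset (Fin n))).Sized r)
    (h1 : p0.choose r ≤ #A) (h2 : #A ≤ P.choose r)
    (hR : ∀ p, p0 ≤ p → p ≤ P → p.choose r + R ≤ p.choose (r - s)) :
    #A + R ≤ #(∂^[s] A) := by
  induction P, hpP using Nat.le_induction with
  | base =>
    have := kruskal_katona_lovasz_form (i := s) (k := p0) (by omega) hrp hP hA h1
    have := hR p0 le_rfl le_rfl
    omega
  | succ P hpP ih =>
    by_cases h3 : #A ≤ P.choose r
    · exact ih (by omega) h3 (fun p hp hp' => hR p hp (by omega))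
    · obtain ⟨D, hD, hDc, hDs⟩ := hx_decomp hP (by omega) (by omega : s ≤ r) A hA (by omega) h2
      have hl := hx_lym (s := s) hsr (by rw [hxV_card (by omega)]; omega) D hD
      rw [hxV_card (by omega)] at hl
      have hR1 := hR P hpP (by omega)
      have hR2 := hR (P+1) (by omega) le_rfl
      obtain ⟨r', rfl⟩ : ∃ r', r = r' + 1 := ⟨r - 1, by omega⟩
      have e1 : (P+1).choose (r'+1) = P.choose r' + P.choose (r'+1) := Nat.choose_succ_succ _ _
      have e2 : (P+1).choose (r'+1-s) = P.choose (r'-s) + P.choose (r'+1-s) := by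
        rw [show r' + 1 - s = (r' - s) + 1 by omega]; exact Nat.choose_succ_succ _ _
      simp only [Nat.add_sub_cancel] at hl hD hDc
      set x := P.choose r'
      set y := P.choose (r' - s)
      set d := #D
      set t := #(∂^[s] D)
      have hxpos : 0 < x := Nat.choose_pos (by omega)
      have hdx : d ≤ x := by omega
      rcases le_total x y with hxy | hxy
      · have : d ≤ t := by
          by_contra hlt
          push Not at hlt
          nlinarith
        omega
      · -- t ≥ d - (x-y)
        have : d + y ≤ t + x := by
          by_contra hlt
          push Not at hlt
          nlinarith
        omega
end

section
open Finset
open scoped FinsetFamily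

/-- `b`-subsets of `U` disjoint from some member of `P`. -/
def hxNb (U : Finset ℕ) (b : ℕ) (P : Finset (Finset ℕ)) : Finset (Finset ℕ) :=
  (powersetCard b U).filter (fun Y => ∃ X ∈ P, Disjoint X Y)

lemma hx_mem_nb {U : Finset ℕ} {b : ℕ} {P : Finset (Finset ℕ)} {Y : Finset ℕ} :
    Y ∈ hxNb U b P ↔ (Y ⊆ U ∧ #Y = b) ∧ ∃ X ∈ P, Disjoint X Y := by
  rw [hxNb, mem_filter, mem_powersetCard]

lemma hx_nb_mono {U : Finset ℕ} {b : ℕ} {P Q : Finset (Finset ℕ)} (h : P ⊆ Q) :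
    hxNb U b P ⊆ hxNb U b Q := by
  intro Y hY
  rw [hx_mem_nb] at hY ⊢
  obtain ⟨h1, X, hX, hd⟩ := hY
  exact ⟨h1, X, h hX, hd⟩

lemma hx_cross {U : Finset ℕ} {b : ℕ} {P Q : Finset (Finset ℕ)}
    (hQ : Q ⊆ powersetCard b U) (h : ∀ X ∈ P, ∀ Y ∈ Q, ¬ Disjoint X Y) :
    #Q + #(hxNb U b P) ≤ (#U).choose b := by
  rw [← card_powersetCard, ← card_union_of_disjoint]
  · apply card_le_card
    exact union_subset hQ (filter_subset _ _)
  · rw [Finset.disjoint_left]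
    intro Y hY hY'
    rw [hx_mem_nb] at hY'
    obtain ⟨-, X, hX, hd⟩ := hY'
    exact h X hX Y hY hd

lemma hx_transfer {U : Finset ℕ} {r b : ℕ} {P : Finset (Finset ℕ)}
    (hP : P ⊆ powersetCard r U) (hb : b ≤ #U - r) :
    ∃ A : Finset (Finset (Fin #U)), (A : Set (Finset (Fin #U))).Sized (#U - r) ∧ #A = #P ∧
      #(∂^[#U - r - b] A) ≤ #(hxNb U b P) := by
  classical
  set f : Fin #U ↪ ℕ := (U.orderEmbOfFin rfl).toEmbedding with hf
  have hfU : univ.map f = U := by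
    rw [hf]; ext x; simp
  let c : Finset ℕ → Finset (Fin #U) := fun X => univ.filter (fun i => f i ∉ X)
  have hcm : ∀ X, X ⊆ U → (c X).map f = U \ X := by
    intro X hX
    ext x
    simp only [c, mem_map, mem_filter, mem_univ, true_and, mem_sdiff]
    constructor
    · rintro ⟨i, hi, rfl⟩
      refine ⟨?_, hi⟩
      exact hfU.subset (mem_map_of_mem _ (mem_univ _))
    · rintro ⟨h1, h2⟩
      have h1 := mem_map.1 (hfU.symm.subset h1)
      obtain ⟨i, -, rfl⟩ := h1
      exact ⟨i, h2, rfl⟩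
  have hPU : ∀ X ∈ P, X ⊆ U ∧ #X = r := fun X hX => mem_powersetCard.1 (hP hX)
  refine ⟨P.image c, ?_, ?_, ?_⟩
  · intro Z hZ
    rw [mem_coe, mem_image] at hZ
    obtain ⟨X, hX, rfl⟩ := hZ
    rw [← card_map f, hcm X (hPU X hX).1, card_sdiff_of_subset (hPU X hX).1, (hPU X hX).2]
  · apply card_image_of_injOn
    intro X hX X' hX' h
    have h : c X = c X' := h
    have h1 := hcm X (hPU X hX).1
    have h2 := hcm X' (hPU X' hX').1
    rw [h, h2] at h1
    rw [← Finset.sdiff_sdiff_eq_self (hPU X hX).1, ← h1, Finset.sdiff_sdiff_eq_self (hPU X' hX').1]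
  · apply card_le_card_of_injOn (fun Z => Z.map f)
    · intro Z hZ
      rw [mem_coe, mem_shadow_iterate_iff_exists_mem_card_add] at hZ
      obtain ⟨W, hW, hZW, hc⟩ := hZ
      rw [mem_image] at hW
      obtain ⟨X, hX, rfl⟩ := hW
      have e1 := hcm X (hPU X hX).1
      have e2 : #(c X) = #U - r := by
        rw [← card_map f, e1, card_sdiff_of_subset (hPU X hX).1, (hPU X hX).2]
      have e3 : Z.map f ⊆ U \ X := by rw [← e1]; exact map_subset_map.2 hZW
      rw [mem_coe, hx_mem_nb]
      refine ⟨⟨e3.trans sdiff_subset, ?_⟩, X, hX, ?_⟩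
      · rw [card_map]; omega
      · exact (disjoint_of_subset_right e3 disjoint_sdiff)
    · intro Z _ Z' _ h
      exact map_injective f h

lemma hx_KU {U : Finset ℕ} {r b p0 P R : ℕ} {A : Finset (Finset ℕ)}
    (hA : A ⊆ powersetCard r U) (hr : r < #U) (hb1 : 1 ≤ b) (hb : b ≤ #U - r)
    (hp0 : #U - r ≤ p0) (hpP : p0 ≤ P) (hP : P ≤ #U)
    (h1 : p0.choose (#U - r) ≤ #A) (h2 : #A ≤ P.choose (#U - r))
    (hR : ∀ p, p0 ≤ p → p ≤ P → p.choose (#U - r) + R ≤ p.choose b) :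
    #A + R ≤ #(hxNb U b A) := by
  obtain ⟨A', hA', hc, hs⟩ := hx_transfer hA hb
  have := hx_K (n := #U) (r := #U - r) (s := #U - r - b) (p0 := p0) (P := P) (R := R)
    (by omega) hp0 (by omega) hP hpP A' hA' (by omega) (by omega)
    (by rwa [show #U - r - (#U - r - b) = b by omega])
  omega

lemma hx_kneser {U : Finset ℕ} {r b : ℕ} {P : Finset (Finset ℕ)}
    (hP : P ⊆ powersetCard r U) :
    #P * (#U - r).choose b ≤ #(hxNb U b P) * (#U - b).choose r := by
  apply card_mul_le_card_mul (fun X Y => Disjoint X Y)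
  · intro X hX
    have hX' := mem_powersetCard.1 (hP hX)
    rw [← hX'.2, ← card_sdiff_of_subset hX'.1, ← card_powersetCard]
    apply card_le_card
    intro Y hY
    rw [mem_powersetCard] at hY
    rw [mem_bipartiteAbove, hx_mem_nb]
    have hd : Disjoint X Y := disjoint_of_subset_right hY.1 disjoint_sdiff
    exact ⟨⟨⟨hY.1.trans sdiff_subset, hY.2⟩, X, hX, hd⟩, hd⟩
  · intro Y hY
    rw [hx_mem_nb] at hY
    rw [← hY.1.2, ← card_sdiff_of_subset hY.1.1, ← card_powersetCard]
    apply card_le_card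
    intro X hX
    rw [mem_bipartiteBelow] at hX
    have hX' := mem_powersetCard.1 (hP hX.1)
    rw [mem_powersetCard]
    refine ⟨?_, hX'.2⟩
    exact subset_sdiff.2 ⟨hX'.1, hX.2⟩

/-- Trace family. -/
def hxTr (F : Finset (Finset ℕ)) (T S : Finset ℕ) : Finset (Finset ℕ) :=
  (F.filter (fun X => X ∩ T = S)).image (fun X => X \ T)

lemma hx_mem_tr {F : Finset (Finset ℕ)} {T S Y : Finset ℕ} :
    Y ∈ hxTr F T S ↔ ∃ X ∈ F, X ∩ T = S ∧ X \ T = Y := by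
  simp only [hxTr, mem_image, mem_filter, and_assoc]

lemma hx_card_tr (F : Finset (Finset ℕ)) (T S : Finset ℕ) :
    #(hxTr F T S) = #(F.filter (fun X => X ∩ T = S)) := by
  apply card_image_of_injOn
  intro X hX X' hX' h
  have h : X \ T = X' \ T := h
  rw [mem_coe, mem_filter] at hX hX'
  rw [← sdiff_union_inter X T, ← sdiff_union_inter X' T, h, hX.2, hX'.2]

lemma hx_tr_sub {F : Finset (Finset ℕ)} {V : Finset ℕ} {k : ℕ} (hF : F ⊆ powersetCard k V)
    (T S : Finset ℕ) : hxTr F T S ⊆ powersetCard (k - #S) (V \ T) := by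
  intro Y hY
  rw [hx_mem_tr] at hY
  obtain ⟨X, hX, hS, rfl⟩ := hY
  have hX' := mem_powersetCard.1 (hF hX)
  rw [mem_powersetCard]
  refine ⟨sdiff_subset_sdiff hX'.1 (le_refl _), ?_⟩
  have := card_sdiff_add_card_inter X T
  rw [hS] at this
  omega

lemma hx_tr_cross {F : Finset (Finset ℕ)} (hF : Intersecting F) {T S S' : Finset ℕ}
    (hS : Disjoint S S') : ∀ X ∈ hxTr F T S, ∀ Y ∈ hxTr F T S', ¬ Disjoint X Y := by
  intro X hX Y hY hd
  rw [hx_mem_tr] at hX hY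
  obtain ⟨X, hX, rfl, rfl⟩ := hX
  obtain ⟨Y, hY, rfl, rfl⟩ := hY
  obtain ⟨z, hz⟩ := hF X hX Y hY
  rw [mem_inter] at hz
  rw [Finset.disjoint_left] at hS hd
  by_cases hzT : z ∈ T
  · exact hS (mem_inter.2 ⟨hz.1, hzT⟩) (mem_inter.2 ⟨hz.2, hzT⟩)
  · exact hd (mem_sdiff.2 ⟨hz.1, hzT⟩) (mem_sdiff.2 ⟨hz.2, hzT⟩)

lemma hx_tr_sum (F : Finset (Finset ℕ)) (T : Finset ℕ) :
    #F = ∑ S ∈ T.powerset, #(hxTr F T S) := by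
  simp_rw [hx_card_tr]
  exact card_eq_sum_card_fiberwise (fun X _ => mem_powerset.2 inter_subset_right)

lemma hx_tr_sum1 (F : Finset (Finset ℕ)) (x : ℕ) :
    #F = #(hxTr F {x} ∅) + #(hxTr F {x} {x}) := by
  rw [hx_tr_sum F {x}, ← insert_empty_eq x, sum_powerset_insert (by simp)]
  simp

lemma hx_tr_sum2 (F : Finset (Finset ℕ)) {i j : ℕ} (hij : i ≠ j) :
    #F = #(hxTr F {i, j} ∅) + #(hxTr F {i, j} {j}) + #(hxTr F {i, j} {i})
      + #(hxTr F {i, j} {i, j}) := by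
  rw [hx_tr_sum F {i, j}, sum_powerset_insert (by simpa using hij), ← insert_empty_eq j,
    sum_powerset_insert (by simp), sum_powerset_insert (by simp)]
  simp
  ring

lemma hx_tr_sum3 (F : Finset (Finset ℕ)) :
    #F = #(hxTr F {1, 2, 3} ∅) + #(hxTr F {1, 2, 3} {1}) + #(hxTr F {1, 2, 3} {2})
      + #(hxTr F {1, 2, 3} {3}) + #(hxTr F {1, 2, 3} {1, 2}) + #(hxTr F {1, 2, 3} {1, 3})
      + #(hxTr F {1, 2, 3} {2, 3}) + #(hxTr F {1, 2, 3} {1, 2, 3}) := by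
  rw [hx_tr_sum F {1, 2, 3}, sum_powerset_insert (by simp), sum_powerset_insert (by simp),
    sum_powerset_insert (by simp), ← insert_empty_eq 3,
    sum_powerset_insert (by simp), sum_powerset_insert (by simp), sum_powerset_insert (by simp),
    sum_powerset_insert (by simp)]
  simp
  ring
end

section
open Finset
open scoped FinsetFamily

lemma hx_choose_mono_half {p j m : ℕ} (hjm : j ≤ m) (h : 2 * m ≤ p) : p.choose j ≤ p.choose m := by
  induction m, hjm using Nat.le_induction with
  | base => exact le_refl _
  | succ m hm ih => exact (ih (by omega)).trans (Nat.choose_le_succ_of_lt_half_left (by omega))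

lemma hx_choose_mono {p j m : ℕ} (hjm : j ≤ m) (h : j + m ≤ p) : p.choose j ≤ p.choose m := by
  by_cases h2 : 2 * m ≤ p
  · exact hx_choose_mono_half hjm h2
  · rw [← Nat.choose_symm (show m ≤ p by omega)]
    exact hx_choose_mono_half (by omega) (by omega)

lemma hx_choose_two (v : ℕ) : 2 * (v + 1).choose 2 = (v + 1) * v := by
  have := Nat.add_one_mul_choose_eq v 1
  simp at this
  omega

/-- basic lower bounds: `w = v+2`, `a = c+4`. -/
lemma hx_basic {v c : ℕ} (h : c + 3 ≤ v) :
    (v + 1) * v ≤ 2 * (v + 1).choose (c + 2) ∧ v + 1 ≤ (v + 1).choose (c + 1) ∧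
      v ≤ v.choose (c + 2) ∧ v + 1 ≤ (v + 1).choose (c + 2) := by
  have h1 : (v + 1).choose 2 ≤ (v + 1).choose (c + 2) := hx_choose_mono (by omega) (by omega)
  have h2 : (v + 1).choose 1 ≤ (v + 1).choose (c + 1) := hx_choose_mono (by omega) (by omega)
  have h3 : v.choose 1 ≤ v.choose (c + 2) := hx_choose_mono (by omega) (by omega)
  have h4 : (v + 1).choose 1 ≤ (v + 1).choose (c + 2) := hx_choose_mono (by omega) (by omega)
  have := hx_choose_two v
  rw [Nat.choose_one_right] at h2 h3 h4
  exact ⟨by omega, h2, h3, h4⟩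

lemma hx_phi {v c : ℕ} (h : c + 3 ≤ v) (p : ℕ) (hp : v + 4 ≤ p) (hp2 : p ≤ v + c + 5) :
    p.choose (v + 2) + 2 * (v + 2).choose (c + 4) ≤ p.choose (c + 4) + v.choose (c + 4) + 2 := by
  induction p, hp using Nat.le_induction with
  | base =>
    obtain ⟨b1, b2, b3, b4⟩ := hx_basic h
    rw [show (v + 4).choose (v + 2) = (v + 4).choose 2 from
      Nat.choose_symm_of_eq_add (by omega)]
    have := hx_choose_two (v + 3)
    simp only [Nat.choose_succ_succ' _ (c + 3), Nat.choose_succ_succ' _ (c + 2),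
      Nat.choose_succ_succ' _ (c + 1)] at *
    nlinarith
  | succ p hp ih =>
    have ih := ih (by omega)
    rw [show (p + 1).choose (v + 2) = p.choose (v + 1) + p.choose (v + 2) from
      Nat.choose_succ_succ' p (v + 1), show (p + 1).choose (c + 4) = p.choose (c + 3) +
      p.choose (c + 4) from Nat.choose_succ_succ' p (c + 3)]
    have : p.choose (v + 1) ≤ p.choose (c + 3) := by
      rw [← Nat.choose_symm (show v + 1 ≤ p by omega)]
      exact hx_choose_mono (by omega) (by omega)
    omega

lemma hx_stepI' {v c : ℕ} (h : c + 3 ≤ v) {U : Finset ℕ} (hU : #U = v + c + 7)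
    {B : Finset (Finset ℕ)} (hB : B ⊆ powersetCard (c + 5) U) (h1 : v + 4 ≤ #B)
    (h2 : #B ≤ (v + c + 5).choose (v + 2)) :
    #B + 2 * (v + 2).choose (c + 4) ≤ #(hxNb U (c + 4) B) + v.choose (c + 4) + 2 := by
  have hsub : #U - (c + 5) = v + 2 := by omega
  have hmon : v.choose (c + 4) ≤ (v + 2).choose (c + 4) := Nat.choose_le_choose _ (by omega)
  by_cases hc : (v + 4).choose (v + 2) ≤ #B
  · by_cases hpos : v.choose (c + 4) + 2 ≤ 2 * (v + 2).choose (c + 4)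
    · have := hx_KU (R := 2 * (v + 2).choose (c + 4) - (v.choose (c + 4) + 2)) hB (by omega)
        (by omega : 1 ≤ c + 4) (by omega) (p0 := v + 4) (P := v + c + 5) (by omega) (by omega)
        (by omega) (by rwa [hsub]) (by rwa [hsub])
        (by intro p hp hp2; rw [hsub]; have := hx_phi h p hp hp2; omega)
      omega
    · have := hx_KU (R := 0) hB (by omega)
        (by omega : 1 ≤ c + 4) (by omega) (p0 := v + 4) (P := v + c + 5) (by omega) (by omega)
        (by omega) (by rwa [hsub]) (by rwa [hsub])
        (by
          intro p hp hp2; rw [hsub, ← Nat.choose_symm (show v + 2 ≤ p by omega)]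
          exact hx_choose_mono (by omega) (by omega))
      omega
  · obtain ⟨A, hA, hAc, hAs⟩ := hx_transfer (b := c + 4) hB (by omega)
    rw [hsub] at hA hAs
    have e1 : (v + 3).choose (v + 2) = v + 3 := Nat.choose_succ_self_right (v + 2)
    obtain ⟨D, hD, hDc, hDs⟩ := hx_decomp (p := v + 3) (r := v + 2) (s := v + 2 - (c + 4))
      (by omega) (by omega) (by omega) A hA (by rw [e1]; omega)
      (by rw [hAc]; show _ ≤ (v + 4).choose (v + 2); omega)
    obtain ⟨b1, b2, b3, b4⟩ := hx_basic h
    have hDsz : (D : Set (Finset (Fin #U))).Sized (v + 1) :=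
      fun X hX => (mem_powersetCard.1 (hD hX)).2
    have hDle : #D ≤ (v + 3).choose (v + 1) := by
      have := card_le_card hD
      rwa [card_powersetCard, hxV_card (by omega)] at this
    have hsym : (v + 3).choose (v + 1) = (v + 3).choose 2 := Nat.choose_symm_of_eq_add (by omega)
    have h22 := hx_choose_two (v + 2)
    have hK := hx_K (r := v + 1) (s := v + 2 - (c + 4)) (p0 := v + 1) (P := v + 3)
      (R := (v + 1).choose (c + 3) - 1) (by omega) (by omega) (by omega) (by omega) (by omega)
      D hDsz (by rw [Nat.choose_self]; omega) hDle (by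
        intro p hp hp2
        have hs2 : v + 1 - (v + 2 - (c + 4)) = c + 3 := by omega
        have hpos : 1 ≤ (v + 1).choose (c + 3) := Nat.choose_pos (by omega)
        rw [hs2]
        obtain rfl | rfl | rfl : p = v + 1 ∨ p = v + 2 ∨ p = v + 3 := by omega
        · rw [Nat.choose_self]; omega
        · have i2 : (v + 2).choose (c + 3) = (v + 1).choose (c + 2) + (v + 1).choose (c + 3) :=
            Nat.choose_succ_succ' (v + 1) (c + 2)
          rw [Nat.choose_succ_self_right, i2]
          omega
        · rw [hsym]
          have i1 := Nat.choose_succ_succ' (v + 2) (c + 2)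
          have i2 := Nat.choose_succ_succ' (v + 1) (c + 2)
          have i3 := Nat.choose_succ_succ' (v + 1) (c + 1)
          have : 2 * ((v + 3).choose 2 + ((v + 1).choose (c + 3) - 1)) ≤
            2 * (v + 3).choose (c + 3) := by
            zify [hpos] at *
            nlinarith
          omega)
    have hs3 : v + 2 - (v + 2 - (c + 4)) = c + 4 := by omega
    have i1 := Nat.choose_succ_succ' (v + 2) (c + 3)
    have i2 := Nat.choose_succ_succ' (v + 1) (c + 3)
    have i3 := Nat.choose_succ_succ' v (c + 3)
    have i4 := Nat.choose_succ_succ' (v + 1) (c + 2)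
    have i5 := Nat.choose_succ_succ' v (c + 2)
    have hpos : 1 ≤ (v + 1).choose (c + 3) := Nat.choose_pos (by omega)
    rw [hs3] at hDs
    simp only [add_assoc, Nat.reduceAdd] at *
    omega
end

section
open Finset
open scoped FinsetFamily

lemma hx_nb_pair {U : Finset ℕ} {b k : ℕ} {X Y : Finset ℕ} (hX : X ⊆ U) (hY : Y ⊆ U)
    (hXk : #X = k) (hYk : #Y = k) :
    #(hxNb U b {X, Y}) + (#U - #(X ∪ Y)).choose b = 2 * (#U - k).choose b := by
  have h1 : hxNb U b {X, Y} = powersetCard b (U \ X) ∪ powersetCard b (U \ Y) := by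
    ext Z
    simp only [hx_mem_nb, mem_union, mem_powersetCard, subset_sdiff, mem_insert, mem_singleton,
      exists_eq_or_imp, exists_eq_left, disjoint_comm]
    tauto
  have h2 : powersetCard b (U \ X) ∩ powersetCard b (U \ Y) = powersetCard b (U \ (X ∪ Y)) := by
    ext Z
    simp only [mem_inter, mem_powersetCard, subset_sdiff, disjoint_union_right]
    tauto
  have := card_union_add_card_inter (powersetCard b (U \ X)) (powersetCard b (U \ Y))
  rw [h2, ← h1] at this
  rw [card_powersetCard, card_powersetCard, card_powersetCard, card_sdiff_of_subset hX,
    card_sdiff_of_subset hY, card_sdiff_of_subset (union_subset hX hY), hXk, hYk] at this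
  omega

lemma hx_nb_triple {U : Finset ℕ} {b k : ℕ} {B : Finset (Finset ℕ)} {X Y Z T : Finset ℕ}
    (hX : X ⊆ U) (hY : Y ⊆ U) (hZ : Z ⊆ U)
    (hXk : #X = k) (hYk : #Y = k) (hZk : #Z = k) (hXB : X ∈ B) (hYB : Y ∈ B) (hZB : Z ∈ B)
    (hT : T ⊆ U \ Z) (hTX : ¬ Disjoint X T) (hTY : ¬ Disjoint Y T) (hTb : #T ≤ b) :
    2 * (#U - k).choose b + (#U - k - #T).choose (b - #T)
      ≤ #(hxNb U b B) + (#U - #(X ∪ Y)).choose b := by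
  have hp := hx_nb_pair (b := b) hX hY hXk hYk
  have hnew : #((powersetCard (b - #T) ((U \ Z) \ T)).image (fun S => S ∪ T)) =
      (#U - k - #T).choose (b - #T) := by
    rw [card_image_of_injOn, card_powersetCard, card_sdiff_of_subset hT, card_sdiff_of_subset hZ,
      hZk]
    intro S hS S' hS' h
    have h : S ∪ T = S' ∪ T := h
    rw [mem_coe, mem_powersetCard, subset_sdiff] at hS hS'
    rw [← union_sdiff_cancel_right hS.1.2, h, union_sdiff_cancel_right hS'.1.2]
  have hdisj : Disjoint (hxNb U b {X, Y})
      ((powersetCard (b - #T) ((U \ Z) \ T)).image (fun S => S ∪ T)) := by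
    rw [Finset.disjoint_left]
    intro W hW hW'
    rw [mem_image] at hW'
    obtain ⟨S, -, rfl⟩ := hW'
    rw [hx_mem_nb] at hW
    obtain ⟨-, V, hV, hd⟩ := hW
    rw [disjoint_union_right] at hd
    simp only [mem_insert, mem_singleton] at hV
    rcases hV with rfl | rfl
    · exact hTX hd.2
    · exact hTY hd.2
  have hsub : hxNb U b {X, Y} ∪
      ((powersetCard (b - #T) ((U \ Z) \ T)).image (fun S => S ∪ T)) ⊆ hxNb U b B := by
    apply union_subset
    · apply hx_nb_mono
      intro V hV
      simp only [mem_insert, mem_singleton] at hV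
      rcases hV with rfl | rfl <;> assumption
    · intro W hW
      rw [mem_image] at hW
      obtain ⟨S, hS, rfl⟩ := hW
      rw [mem_powersetCard] at hS
      obtain ⟨hS, hSc⟩ := hS
      have hST := (subset_sdiff.1 hS).2
      have hSZ : S ∪ T ⊆ U \ Z := union_subset (hS.trans sdiff_subset) hT
      rw [hx_mem_nb]
      refine ⟨⟨hSZ.trans sdiff_subset, ?_⟩, Z, hZB, ?_⟩
      · rw [card_union_of_disjoint hST]; omega
      · exact disjoint_of_subset_right hSZ disjoint_sdiff
  have := card_le_card hsub
  rw [card_union_of_disjoint hdisj, hnew] at this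
  omega

lemma hx_stepIV {v c : ℕ} (h : c + 3 ≤ v) {U : Finset ℕ} (hU : #U = v + c + 7)
    {B : Finset (Finset ℕ)} (hB : B ⊆ powersetCard (c + 5) U) (h1 : 2 ≤ #B)
    (h2 : #B ≤ v + 3) (hK : ¬ ∃ K ⊆ U, #K = c + 4 ∧ ∀ X ∈ B, K ⊆ X) :
    #B + 2 * (v + 2).choose (c + 4) ≤ #(hxNb U (c + 4) B) + v.choose (c + 4) + 2 := by
  have hw : #U - (c + 5) = v + 2 := by omega
  have hBU : ∀ X ∈ B, X ⊆ U ∧ #X = c + 5 := fun X hX => mem_powersetCard.1 (hB hX)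
  obtain ⟨b1, b2, b3, b4⟩ := hx_basic h
  -- strong bound suffices
  have key : ∀ Q : Prop, (3 ≤ #B → 2 * (v + 2).choose (c + 4) + v.choose (c + 2) ≤
      #(hxNb U (c + 4) B) + v.choose (c + 4)) → 3 ≤ #B →
      #B + 2 * (v + 2).choose (c + 4) ≤ #(hxNb U (c + 4) B) + v.choose (c + 4) + 2 := by
    intro _ hs h3
    have hs := hs h3
    by_cases hm : #B ≤ v + 2
    · omega
    by_cases hv : c + 4 ≤ v
    · have e1 : v.choose 2 ≤ v.choose (c + 2) := hx_choose_mono (by omega) (by omega)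
      obtain ⟨u, rfl⟩ : ∃ u, v = u + 1 := ⟨v - 1, by omega⟩
      have e2 := hx_choose_two u
      have : u + 2 ≤ (u + 1).choose 2 := by nlinarith
      omega
    · obtain rfl : v = c + 3 := by omega
      have e1 : (c + 6).choose (c + 5) = c + 6 := Nat.choose_succ_self_right _
      have e2 : (c + 5).choose (c + 4) = c + 5 := Nat.choose_succ_self_right _
      have e3 : (c + 3).choose (c + 4) = 0 := Nat.choose_eq_zero_of_lt (by omega)
      have e4 : (c + 6).choose (c + 4) = (c + 6).choose 2 := Nat.choose_symm_of_eq_add (by omega)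
      have e5 := hx_choose_two (c + 5)
      have e6 : 3 * c + 14 ≤ (c + 6).choose 2 := by simp only [add_assoc, Nat.reduceAdd] at e5; nlinarith
      have := hx_KU (R := 2 * c + 8) hB (by omega)
        (by omega : 1 ≤ c + 4) (by omega) (p0 := c + 6) (P := c + 6) (by omega) (by omega)
        (by omega) (by rw [hw]; simp only [add_assoc, Nat.reduceAdd]; omega)
        (by rw [hw]; simp only [add_assoc, Nat.reduceAdd]; omega)
        (by
          intro p hp hp2
          obtain rfl : p = c + 6 := by omega
          rw [hw]; simp only [add_assoc, Nat.reduceAdd]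
          omega)
      simp only [add_assoc, Nat.reduceAdd] at *
      omega
  by_cases hi : ∃ X ∈ B, ∃ Y ∈ B, #(X ∩ Y) ≤ c + 3
  · obtain ⟨X, hX, Y, hY, hXY⟩ := hi
    obtain ⟨hXU, hXc⟩ := hBU X hX
    obtain ⟨hYU, hYc⟩ := hBU Y hY
    have hun := card_union_add_card_inter X Y
    have hle : (#U - #(X ∪ Y)).choose (c + 4) ≤ v.choose (c + 4) :=
      Nat.choose_le_choose _ (by omega)
    by_cases h3 : 3 ≤ #B
    · apply key True _ h3
      intro _
      obtain ⟨Z, hZ, hZX⟩ : ∃ Z ∈ B, Z ∉ ({X, Y} : Finset (Finset ℕ)) := by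
        apply exists_mem_notMem_of_card_lt_card
        exact (card_le_two).trans_lt h3
      obtain ⟨hZU, hZc⟩ := hBU Z hZ
      simp only [mem_insert, mem_singleton, not_or] at hZX
      have hne : ∀ W ∈ B, Z ≠ W → ∃ y ∈ W, y ∉ Z := by
        intro W hW hZW
        by_contra hcon
        push Not at hcon
        have hWc := (hBU W hW).2
        exact hZW (eq_of_subset_of_card_le hcon (by omega)).symm
      obtain ⟨y, hy, hyZ⟩ := hne X hX hZX.1
      obtain ⟨z, hz, hzZ⟩ := hne Y hY hZX.2
      have hUZ : #(U \ Z) = v + 2 := by rw [card_sdiff_of_subset hZU]; omega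
      obtain ⟨T, hT1, hT2, hT3⟩ := exists_subsuperset_card_eq (s := {y, z}) (t := U \ Z) (n := 2)
        (by
          intro u hu
          simp only [mem_insert, mem_singleton] at hu
          rcases hu with rfl | rfl
          · exact mem_sdiff.2 ⟨hXU hy, hyZ⟩
          · exact mem_sdiff.2 ⟨hYU hz, hzZ⟩) card_le_two (by omega)
      have := hx_nb_triple (b := c + 4) hXU hYU hZU hXc hYc hZc hX hY hZ hT2
        (not_disjoint_iff.2 ⟨y, hy, hT1 (by simp)⟩) (not_disjoint_iff.2 ⟨z, hz, hT1 (by simp)⟩)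
        (by omega)
      rw [hT3, hw] at this
      simp only [Nat.add_sub_cancel, show c + 4 - 2 = c + 2 by omega] at this
      omega
    · have hp := hx_nb_pair (b := c + 4) hXU hYU hXc hYc
      have := card_le_card (hx_nb_mono (U := U) (b := c + 4) (P := {X, Y}) (Q := B) (by
        intro V hV
        simp only [mem_insert, mem_singleton] at hV
        rcases hV with rfl | rfl <;> assumption))
      rw [hw] at hp
      omega
  · push Not at hi
    obtain ⟨X, hX, Y, hY, hne⟩ := one_lt_card.1 (show 1 < #B by omega)
    obtain ⟨hXU, hXc⟩ := hBU X hX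
    obtain ⟨hYU, hYc⟩ := hBU Y hY
    have hun := card_union_add_card_inter X Y
    have hXY := hi X hX Y hY
    have hlt : #(X ∩ Y) < c + 5 := by
      by_contra hcon
      have e1 : X ∩ Y = X := eq_of_subset_of_card_le inter_subset_left (by omega)
      have e2 : X ∩ Y = Y := eq_of_subset_of_card_le inter_subset_right (by omega)
      exact hne (e1.symm.trans e2)
    have hKc : #(X ∩ Y) = c + 4 := by omega
    have : ∃ Z ∈ B, ¬ (X ∩ Y ⊆ Z) := by
      by_contra hcon
      push Not at hcon
      exact hK ⟨X ∩ Y, inter_subset_left.trans hXU, hKc, hcon⟩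
    obtain ⟨Z, hZ, hZK⟩ := this
    obtain ⟨hZU, hZc⟩ := hBU Z hZ
    obtain ⟨y, hy, hyZ⟩ := not_subset.1 hZK
    rw [mem_inter] at hy
    have h3 : 3 ≤ #B := by
      have : #({X, Y, Z} : Finset (Finset ℕ)) = 3 := by
        rw [card_eq_three]
        refine ⟨X, Y, Z, hne, ?_, ?_, rfl⟩
        · rintro rfl; exact hyZ hy.1
        · rintro rfl; exact hyZ hy.2
      rw [← this]
      apply card_le_card
      intro V hV
      simp only [mem_insert, mem_singleton] at hV
      rcases hV with rfl | rfl | rfl <;> assumption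
    apply key True _ h3
    intro _
    have := hx_nb_triple (b := c + 4) (T := {y}) hXU hYU hZU hXc hYc hZc hX hY hZ
      (singleton_subset_iff.2 (mem_sdiff.2 ⟨hXU hy.1, hyZ⟩))
      (not_disjoint_iff.2 ⟨y, hy.1, by simp⟩) (not_disjoint_iff.2 ⟨y, hy.2, by simp⟩)
      (by simp)
    rw [card_singleton, hw, show #U - #(X ∪ Y) = v + 1 by omega] at this
    have i1 : (v + 1).choose (c + 4) = v.choose (c + 3) + v.choose (c + 4) :=
      Nat.choose_succ_succ' _ _
    have i2 : (v + 1).choose (c + 3) = v.choose (c + 2) + v.choose (c + 3) :=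
      Nat.choose_succ_succ' _ _
    simp only [show v + 2 - 1 = v + 1 by omega, show c + 4 - 1 = c + 3 by omega] at this
    omega
end

section
open Finset
open scoped FinsetFamily

lemma hx_J {v c : ℕ} (h : c + 3 ≤ v) :
    (v + c + 7).choose (c + 4) + v.choose (c + 4) + 2 ≤
      #(Jfam (v + c + 8) (c + 5) 3) + 2 * (v + 2).choose (c + 4) := by
  set U := Icc 2 (v + c + 8) with hUdef
  have hU : #U = v + c + 7 := by rw [hUdef, Nat.card_Icc]; omega
  set X := Iset (c + 5) 1 with hX
  set Y := Iset (c + 5) 3 with hY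
  have hXU : X ⊆ U := by
    rw [hX, Iset, hUdef]; exact Icc_subset_Icc (by omega) (by omega)
  have hYU : Y ⊆ U := by
    rw [hY, Iset, hUdef]; exact Icc_subset_Icc (by omega) (by omega)
  have hXc : #X = c + 5 := by rw [hX, Iset, Nat.card_Icc]; omega
  have hYc : #Y = c + 5 := by rw [hY, Iset, Nat.card_Icc]; omega
  have hXY : #(X ∪ Y) = c + 7 := by
    have : X ∪ Y = Icc 2 (c + 8) := by
      ext z; rw [hX, hY, Iset, Iset]; simp only [mem_union, mem_Icc]; omega
    rw [this, Nat.card_Icc]; omega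
  have hne : X ≠ Y := by
    intro e
    have : 2 ∈ Y := by rw [← e, hX, Iset]; simp only [mem_Icc]; omega
    rw [hY, Iset] at this; simp only [mem_Icc] at this; omega
  have hp := hx_nb_pair (b := c + 4) hXU hYU hXc hYc
  rw [hXY, hU, show v + c + 7 - (c + 7) = v by omega,
    show v + c + 7 - (c + 5) = v + 2 by omega] at hp
  have h1U : ∀ Z ⊆ U, 1 ∉ Z := by
    intro Z hZ h1
    have := hZ h1
    rw [hUdef, mem_Icc] at this; omega
  have hsub : ((powersetCard (c + 4) U \ hxNb U (c + 4) {X, Y}).image (insert 1)) ∪ {X, Y} ⊆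
      Jfam (v + c + 8) (c + 5) 3 := by
    intro Z hZ
    rw [Jfam, mem_union]
    rw [mem_union] at hZ
    rcases hZ with hZ | hZ
    · right
      rw [mem_image] at hZ
      obtain ⟨W, hW, rfl⟩ := hZ
      rw [mem_sdiff, hx_mem_nb, mem_powersetCard] at hW
      obtain ⟨hW, hn⟩ := hW
      have hn : ∀ V ∈ ({X, Y} : Finset (Finset ℕ)), ¬ Disjoint V W := by
        intro V hV hd; exact hn ⟨hW, V, hV, hd⟩
      have g : ∀ V ∈ ({X, Y} : Finset (Finset ℕ)), (insert 1 W ∩ V).Nonempty := by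
        intro V hV
        have := hn V hV
        rw [not_disjoint_iff] at this
        obtain ⟨z, hz, hz'⟩ := this
        exact ⟨z, mem_inter.2 ⟨mem_insert_of_mem hz', hz⟩⟩
      rw [mem_filter, mem_powersetCard]
      refine ⟨⟨?_, ?_⟩, mem_insert_self _ _, g X (by simp), g Y (by simp)⟩
      · rw [insert_subset_iff]
        refine ⟨by simp, hW.1.trans ?_⟩
        rw [hUdef]; exact Icc_subset_Icc (by omega) (le_refl _)
      · rw [card_insert_of_notMem (h1U W hW.1), hW.2]
    · left; exact hZ
  have hc := card_le_card hsub
  rw [card_union_of_disjoint, card_image_of_injOn, card_pair hne, card_sdiff_of_subset,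
    card_powersetCard, hU] at hc
  · have : #(hxNb U (c + 4) {X, Y}) ≤ (v + c + 7).choose (c + 4) := by
      rw [← hU, ← card_powersetCard]; exact card_le_card (filter_subset _ _)
    omega
  · exact filter_subset _ _
  · intro W hW W' hW' e
    have e : insert 1 W = insert 1 W' := e
    rw [mem_coe, mem_sdiff, mem_powersetCard] at hW hW'
    rw [← erase_insert (h1U W hW.1.1), e, erase_insert (h1U W' hW'.1.1)]
  · rw [Finset.disjoint_left]
    intro Z hZ hZ'
    rw [mem_image] at hZ
    obtain ⟨W, -, rfl⟩ := hZ
    simp only [mem_insert, mem_singleton] at hZ'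
    rcases hZ' with e | e
    · exact h1U X hXU (e ▸ mem_insert_self _ _)
    · exact h1U Y hYU (e ▸ mem_insert_self _ _)

lemma hx_link {v c : ℕ} {F : Finset (Finset ℕ)}
    (hF : F ⊆ powersetCard (c + 5) (Icc 1 (v + c + 8))) (hint : Intersecting F)
    {x : ℕ} (hx : x ∈ Icc 1 (v + c + 8)) :
    #(Icc 1 (v + c + 8) \ {x}) = v + c + 7 ∧
    hxTr F {x} ∅ ⊆ powersetCard (c + 5) (Icc 1 (v + c + 8) \ {x}) ∧
    #F + #(hxNb (Icc 1 (v + c + 8) \ {x}) (c + 4) (hxTr F {x} ∅)) ≤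
      #(hxTr F {x} ∅) + (v + c + 7).choose (c + 4) := by
  have hU : #(Icc 1 (v + c + 8) \ {x}) = v + c + 7 := by
    rw [card_sdiff_of_subset (singleton_subset_iff.2 hx), Nat.card_Icc, card_singleton]; omega
  refine ⟨hU, by simpa using hx_tr_sub hF {x} ∅, ?_⟩
  have h1 := hx_cross (by simpa using hx_tr_sub hF {x} {x})
    (hx_tr_cross hint (T := {x}) (S := ∅) (S' := {x}) (by simp))
  rw [hU] at h1
  have h2 := hx_tr_sum1 F x
  omega

/-- dichotomy -/
lemma hx_dich {v c : ℕ} (h : c + 3 ≤ v) {F : Finset (Finset ℕ)}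
    (hF : F ⊆ powersetCard (c + 5) (Icc 1 (v + c + 8))) (hint : Intersecting F)
    (hJ : #(Jfam (v + c + 8) (c + 5) 3) < #F) {x : ℕ} (hx : x ∈ Icc 1 (v + c + 8)) :
    #(hxTr F {x} ∅) ≤ v + 3 ∨ (v + c + 5).choose (c + 3) < #(hxTr F {x} ∅) := by
  by_contra hcon
  push Not at hcon
  obtain ⟨hU, hB, hle⟩ := hx_link hF hint hx
  have e : (v + c + 5).choose (c + 3) = (v + c + 5).choose (v + 2) :=
    Nat.choose_symm_of_eq_add (by omega)
  have := hx_stepI' h hU hB (by omega) (by omega)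
  have := hx_J h
  omega

lemma hx_small {v c : ℕ} (h : c + 3 ≤ v) {F : Finset (Finset ℕ)}
    (hF : F ⊆ powersetCard (c + 5) (Icc 1 (v + c + 8))) (hint : Intersecting F)
    (hJ : #(Jfam (v + c + 8) (c + 5) 3) < #F) {x : ℕ} (hx : x ∈ Icc 1 (v + c + 8))
    (hs : #(hxTr F {x} ∅) ≤ v + 3) :
    ∃ K ⊆ (Icc 1 (v + c + 8)).erase x, #K = c + 4 ∧ ∀ A ∈ F, x ∈ A ∨ K ⊆ A := by
  obtain ⟨hU, hB, hle⟩ := hx_link hF hint hx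
  have hex : ∃ K ⊆ Icc 1 (v + c + 8) \ {x}, #K = c + 4 ∧ ∀ X ∈ hxTr F {x} ∅, K ⊆ X := by
    by_cases h2 : 2 ≤ #(hxTr F {x} ∅)
    · by_contra hcon
      have := hx_stepIV h hU hB h2 hs hcon
      have := hx_J h
      omega
    · by_cases h0 : hxTr F {x} ∅ = ∅
      · obtain ⟨K, hK, hKc⟩ := exists_subset_card_eq (s := Icc 1 (v + c + 8) \ {x}) (n := c + 4)
          (by omega)
        exact ⟨K, hK, hKc, by rw [h0]; simp⟩
      · have : #(hxTr F {x} ∅) = 1 := by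
          have := card_pos.2 (nonempty_iff_ne_empty.2 h0)
          omega
        obtain ⟨X, hX⟩ := card_eq_one.1 this
        have hXm := mem_powersetCard.1 (hB (hX ▸ mem_singleton_self X))
        obtain ⟨K, hK, hKc⟩ := exists_subset_card_eq (s := X) (n := c + 4) (by omega)
        refine ⟨K, hK.trans hXm.1, hKc, ?_⟩
        rw [hX]; intro Y hY; rw [mem_singleton.1 hY]; exact hK
  obtain ⟨K, hK, hKc, hKX⟩ := hex
  refine ⟨K, by rwa [← sdiff_singleton_eq_erase], hKc, ?_⟩
  intro A hA
  by_cases hxA : x ∈ A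
  · exact Or.inl hxA
  · right
    apply hKX
    rw [hx_mem_tr]
    refine ⟨A, hA, ?_, ?_⟩
    · exact inter_singleton_of_notMem hxA
    · rw [sdiff_singleton_eq_erase, erase_eq_of_notMem hxA]

/-- `g ≤ |J_3|`. -/
lemma hx_gJ {v c : ℕ} (h : c + 3 ≤ v) :
    3 * (v + c + 5).choose (c + 3) + (v + c + 5).choose (c + 2) ≤
      #(Jfam (v + c + 8) (c + 5) 3) := by
  have h1 := hx_J h
  have h2 := hx_phi h (v + c + 5) (by omega) (by omega)
  have e : (v + c + 5).choose (c + 3) = (v + c + 5).choose (v + 2) :=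
    Nat.choose_symm_of_eq_add (by omega)
  have i1 : (v + c + 7).choose (c + 4) = (v + c + 6).choose (c + 3) + (v + c + 6).choose (c + 4) :=
    Nat.choose_succ_succ' _ _
  have i2 : (v + c + 6).choose (c + 4) = (v + c + 5).choose (c + 3) + (v + c + 5).choose (c + 4) :=
    Nat.choose_succ_succ' _ _
  have i3 : (v + c + 6).choose (c + 3) = (v + c + 5).choose (c + 2) + (v + c + 5).choose (c + 3) :=
    Nat.choose_succ_succ' _ _
  omega
end

section
open Finset
open scoped FinsetFamily

lemma hx_tr_pair (F : Finset (Finset ℕ)) {i j : ℕ} (hij : i ≠ j) :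
    #(hxTr F {i} ∅) = #(hxTr F {i, j} ∅) + #(hxTr F {i, j} {j}) := by
  rw [hx_card_tr, hx_card_tr, hx_card_tr, ← card_union_of_disjoint]
  · congr 1
    ext X
    simp only [mem_union, mem_filter, Finset.ext_iff, mem_inter, mem_insert, mem_singleton,
      notMem_empty, iff_false, not_and]
    constructor
    · rintro ⟨hX, h⟩
      by_cases hj : j ∈ X
      · right; refine ⟨hX, fun z => ?_⟩
        constructor
        · rintro ⟨hz, rfl | rfl⟩
          · exact absurd rfl (h _ hz)
          · rfl
        · rintro rfl; exact ⟨hj, Or.inr rfl⟩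
      · left; refine ⟨hX, fun z hz => ?_⟩
        rintro (rfl | rfl)
        · exact h _ hz rfl
        · exact hj hz
    · rintro (⟨hX, h⟩ | ⟨hX, h⟩)
      · exact ⟨hX, fun z hz e => h z hz (Or.inl e)⟩
      · refine ⟨hX, ?_⟩
        rintro z hz rfl
        exact hij ((h z).1 ⟨hz, Or.inl rfl⟩)
  · rw [Finset.disjoint_left]
    intro X h1 h2
    rw [mem_filter] at h1 h2
    rw [h1.2] at h2
    exact (singleton_ne_empty j) h2.2.symm

lemma hx_PQ {v c : ℕ} (h : c + 3 ≤ v) {U : Finset ℕ} (hU : #U = v + c + 6)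
    {P Q : Finset (Finset ℕ)} (hP : P ⊆ powersetCard (c + 4) U) (hQ : Q ⊆ powersetCard (c + 4) U)
    (hcr : ∀ X ∈ P, ∀ Y ∈ Q, ¬ Disjoint X Y)
    (hP1 : (v + c + 4).choose (c + 2) ≤ #P) (hQ1 : (v + c + 4).choose (c + 2) ≤ #Q) :
    #P + #Q ≤ 2 * (v + c + 5).choose (c + 3) := by
  have hw : #U - (c + 4) = v + 2 := by omega
  have e1 : (v + c + 4).choose (c + 2) = (v + c + 4).choose (v + 2) :=
    Nat.choose_symm_of_eq_add (by omega)
  have e2 : (v + c + 5).choose (c + 3) = (v + c + 5).choose (v + 2) :=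
    Nat.choose_symm_of_eq_add (by omega)
  have i1 : (v + c + 5).choose (c + 4) = (v + c + 4).choose (c + 3) + (v + c + 4).choose (c + 4) :=
    Nat.choose_succ_succ' _ _
  have i2 : (v + c + 5).choose (c + 3) = (v + c + 4).choose (c + 2) + (v + c + 4).choose (c + 3) :=
    Nat.choose_succ_succ' _ _
  have i3 : (v + c + 6).choose (c + 4) = (v + c + 5).choose (c + 3) + (v + c + 5).choose (c + 4) :=
    Nat.choose_succ_succ' _ _
  have hm : (v + c + 5).choose (c + 3) ≤ (v + c + 5).choose (c + 4) :=
    hx_choose_mono (by omega) (by omega)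
  -- main use of Lemma K
  have key : ∀ A ⊆ powersetCard (c + 4) U, (v + c + 4).choose (c + 2) ≤ #A →
      #A ≤ (v + c + 5).choose (c + 3) →
      #A + (v + c + 5).choose (c + 4) ≤ #(hxNb U (c + 4) A) + (v + c + 5).choose (c + 3) := by
    intro A hA hA1 hA2
    have := hx_KU (R := (v + c + 5).choose (c + 4) - (v + c + 5).choose (c + 3)) hA (by omega)
      (by omega : 1 ≤ c + 4) (by omega) (p0 := v + c + 4) (P := v + c + 5) (by omega) (by omega)
      (by omega) (by rw [hw]; omega) (by rw [hw]; omega)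
      (by
        intro p hp hp2
        rw [hw]
        obtain rfl | rfl : p = v + c + 4 ∨ p = v + c + 5 := by omega
        · omega
        · omega)
    omega
  have fin : ∀ A ⊆ powersetCard (c + 4) U, ∀ B ⊆ powersetCard (c + 4) U,
      (∀ X ∈ A, ∀ Y ∈ B, ¬ Disjoint X Y) → (v + c + 4).choose (c + 2) ≤ #A →
      #A ≤ (v + c + 5).choose (c + 3) → #A + #B ≤ 2 * (v + c + 5).choose (c + 3) := by
    intro A hA B hB hAB hA1 hA2
    have h1 := hx_cross hB hAB
    have h2 := key A hA hA1 hA2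
    rw [hU] at h1
    omega
  by_cases hc : #P ≤ (v + c + 5).choose (c + 3)
  · exact fin P hP Q hQ hcr hP1 hc
  · obtain ⟨P', hP', hP'c⟩ := exists_subset_card_eq (s := P) (n := (v + c + 5).choose (c + 3))
      (by omega)
    have h1 := fin P' (hP'.trans hP) Q hQ (fun X hX => hcr X (hP' hX)) (by omega) (by omega)
    have := fin Q hQ P hP (fun X hX Y hY hd => hcr Y hY X hX hd.symm) hQ1 (by omega)
    omega

lemma hx_stepII {v c : ℕ} (h : c + 3 ≤ v) {F : Finset (Finset ℕ)}
    (hF : F ⊆ powersetCard (c + 5) (Icc 1 (v + c + 8))) (hint : Intersecting F)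
    (hJ : #(Jfam (v + c + 8) (c + 5) 3) < #F)
    (hgood : ∀ x ∈ Icc 1 (v + c + 8), (v + c + 5).choose (c + 3) < #(hxTr F {x} ∅))
    {i j : ℕ} (hi : i ∈ Icc 1 (v + c + 8)) (hj : j ∈ Icc 1 (v + c + 8)) (hij : i ≠ j) :
    (v + c + 4).choose (c + 3) < #(hxTr F {i, j} ∅) := by
  by_contra hD
  push Not at hD
  have hU : #(Icc 1 (v + c + 8) \ {i, j}) = v + c + 6 := by
    rw [card_sdiff_of_subset, Nat.card_Icc, card_pair hij]
    · omega
    · intro z hz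
      simp only [mem_insert, mem_singleton] at hz
      rcases hz with rfl | rfl <;> assumption
  have i1 : (v + c + 5).choose (c + 3) = (v + c + 4).choose (c + 2) + (v + c + 4).choose (c + 3) :=
    Nat.choose_succ_succ' _ _
  have i2 : (v + c + 6).choose (c + 3) = (v + c + 5).choose (c + 2) + (v + c + 5).choose (c + 3) :=
    Nat.choose_succ_succ' _ _
  have g1 := hx_tr_pair F hij
  have g2 := hx_tr_pair F hij.symm
  rw [pair_comm j i] at g2
  have gi := hgood i hi
  have gj := hgood j hj
  have hs := hx_tr_sum2 F hij
  have hPQ := hx_PQ h hU (P := hxTr F {i, j} {i}) (Q := hxTr F {i, j} {j})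
    (by simpa using hx_tr_sub hF {i, j} {i}) (by simpa using hx_tr_sub hF {i, j} {j})
    (hx_tr_cross hint (by simpa using hij)) (by omega) (by omega)
  have hDs : hxTr F {i, j} ∅ ⊆ powersetCard (c + 5) (Icc 1 (v + c + 8) \ {i, j}) := by
    simpa using hx_tr_sub hF {i, j} ∅
  have hEs : hxTr F {i, j} {i, j} ⊆ powersetCard (c + 3) (Icc 1 (v + c + 8) \ {i, j}) := by
    simpa [card_pair hij] using hx_tr_sub hF {i, j} {i, j}
  have hDE := hx_cross hEs (hx_tr_cross hint (T := {i, j}) (S := ∅) (S' := {i, j}) (by simp))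
  rw [hU] at hDE
  have hDn : #(hxTr F {i, j} ∅) ≤
      #(hxNb (Icc 1 (v + c + 8) \ {i, j}) (c + 3) (hxTr F {i, j} ∅)) := by
    by_cases h0 : #(hxTr F {i, j} ∅) = 0
    · omega
    have e1 : (v + c + 4).choose (c + 3) = (v + c + 4).choose (v + 1) :=
      Nat.choose_symm_of_eq_add (by omega)
    have hw : #(Icc 1 (v + c + 8) \ {i, j}) - (c + 5) = v + 1 := by omega
    have := hx_KU (R := 0) hDs (by omega)
      (by omega : 1 ≤ c + 3) (by omega) (p0 := v + 1) (P := v + c + 4) (by omega) (by omega)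
      (by omega) (by rw [hw, Nat.choose_self]; omega) (by rw [hw]; omega)
      (by
        intro p hp hp2
        rw [hw, ← Nat.choose_symm (show v + 1 ≤ p by omega)]
        exact hx_choose_mono (by omega) (by omega))
    omega
  have := hx_gJ h
  omega
end

section
open Finset
open scoped FinsetFamily

/-- Replace `j` by `i`, if possible. -/
def hxc (i j : ℕ) (X : Finset ℕ) : Finset ℕ :=
  if i ∉ X ∧ j ∈ X then insert i (X.erase j) else X

/-- The map realizing the shift of a family. -/
def hxphi (i j : ℕ) (F : Finset (Finset ℕ)) (X : Finset ℕ) : Finset ℕ :=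
  if hxc i j X ∈ F then X else hxc i j X

/-- The shifted family. -/
def hxS (i j : ℕ) (F : Finset (Finset ℕ)) : Finset (Finset ℕ) := F.image (hxphi i j F)

lemma hxphi_cases {i j : ℕ} {F : Finset (Finset ℕ)} {X : Finset ℕ} (hX : X ∈ F) :
    (hxc i j X ∈ F ∧ hxphi i j F X = X) ∨
    (i ∉ X ∧ j ∈ X ∧ insert i (X.erase j) ∉ F ∧ hxphi i j F X = insert i (X.erase j)) := by
  by_cases h : hxc i j X ∈ F
  · left; exact ⟨h, by rw [hxphi, if_pos h]⟩
  · right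
    have h2 : i ∉ X ∧ j ∈ X := by
      by_contra hc
      rw [hxc, if_neg hc] at h
      exact h hX
    have h3 : hxc i j X = insert i (X.erase j) := by rw [hxc, if_pos h2]
    exact ⟨h2.1, h2.2, h3 ▸ h, by rw [hxphi, if_neg h, h3]⟩

lemma hxphi_inj {i j : ℕ} (F : Finset (Finset ℕ)) :
    Set.InjOn (hxphi i j F) F := by
  intro X hX Y hY h
  rw [mem_coe] at hX hY
  rcases hxphi_cases (i := i) (j := j) hX with ⟨h1, h2⟩ | ⟨h1, h2, h3, h4⟩ <;>
  rcases hxphi_cases (i := i) (j := j) hY with ⟨g1, g2⟩ | ⟨g1, g2, g3, g4⟩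
  · rw [← h2, h, g2]
  · rw [h2, g4] at h; rw [h] at hX; exact absurd hX g3
  · rw [h4, g2] at h; rw [h] at h3; exact absurd hY h3
  · rw [h4, g4] at h
    have e : X.erase j = Y.erase j := by
      rw [← erase_insert (a := i) (s := X.erase j), h, erase_insert]
      · exact fun hh => g1 (mem_of_mem_erase hh)
      · exact fun hh => h1 (mem_of_mem_erase hh)
    rw [← insert_erase h2, e, insert_erase g2]

lemma hxS_card (i j : ℕ) (F : Finset (Finset ℕ)) : #(hxS i j F) = #F :=
  card_image_of_injOn (hxphi_inj F)

lemma hxS_sub {i j k : ℕ} {V : Finset ℕ} {F : Finset (Finset ℕ)} (hi : i ∈ V)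
    (hF : F ⊆ powersetCard k V) : hxS i j F ⊆ powersetCard k V := by
  intro Z hZ
  rw [hxS, mem_image] at hZ
  obtain ⟨X, hX, rfl⟩ := hZ
  have hX' := mem_powersetCard.1 (hF hX)
  rcases hxphi_cases (i := i) (j := j) hX with ⟨h1, h2⟩ | ⟨h1, h2, h3, h4⟩
  · rw [h2]; exact hF hX
  · rw [h4, mem_powersetCard]
    refine ⟨insert_subset hi ((erase_subset _ _).trans hX'.1), ?_⟩
    rw [card_insert_of_notMem (fun hh => h1 (mem_of_mem_erase hh)), card_erase_add_one h2, hX'.2]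

lemma hxS_int {i j : ℕ} {F : Finset (Finset ℕ)} (hF : Intersecting F) :
    Intersecting (hxS i j F) := by
  have key : ∀ X ∈ F, ∀ Y ∈ F, hxc i j X ∈ F → i ∉ Y → j ∈ Y →
      (X ∩ insert i (Y.erase j)).Nonempty := by
    intro X hX Y hY hc hiY hjY
    by_cases hiX : i ∈ X
    · exact ⟨i, mem_inter.2 ⟨hiX, mem_insert_self _ _⟩⟩
    · by_cases hjX : j ∈ X
      · rw [hxc, if_pos ⟨hiX, hjX⟩] at hc
        obtain ⟨z, hz⟩ := hF _ hc _ hY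
        rw [mem_inter, mem_insert, mem_erase] at hz
        refine ⟨z, mem_inter.2 ⟨?_, ?_⟩⟩
        · rcases hz.1 with rfl | hz1
          · exact absurd hz.2 hiY
          · exact hz1.2
        · rcases hz.1 with rfl | hz1
          · exact absurd hz.2 hiY
          · exact mem_insert_of_mem (mem_erase.2 ⟨hz1.1, hz.2⟩)
      · obtain ⟨z, hz⟩ := hF _ hX _ hY
        rw [mem_inter] at hz
        refine ⟨z, mem_inter.2 ⟨hz.1, mem_insert_of_mem (mem_erase.2 ⟨?_, hz.2⟩)⟩⟩
        rintro rfl; exact hjX hz.1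
  intro A hA B hB
  rw [hxS, mem_image] at hA hB
  obtain ⟨X, hX, rfl⟩ := hA
  obtain ⟨Y, hY, rfl⟩ := hB
  rcases hxphi_cases (i := i) (j := j) hX with ⟨h1, h2⟩ | ⟨h1, h2, h3, h4⟩ <;>
  rcases hxphi_cases (i := i) (j := j) hY with ⟨g1, g2⟩ | ⟨g1, g2, g3, g4⟩
  · rw [h2, g2]; exact hF _ hX _ hY
  · rw [h2, g4]; exact key X hX Y hY h1 g1 g2
  · rw [h4, g2, inter_comm]; exact key Y hY X hX g1 h1 h2
  · rw [h4, g4]; exact ⟨i, by simp⟩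

lemma hx_tr1 (F : Finset (Finset ℕ)) (x : ℕ) :
    #(hxTr F {x} ∅) = #(F.filter (fun X => x ∉ X)) := by
  rw [hx_card_tr]; congr 1; ext X
  simp only [mem_filter, ← disjoint_iff_inter_eq_empty, disjoint_singleton_right]

lemma hx_tr2 (F : Finset (Finset ℕ)) (x y : ℕ) :
    #(hxTr F {x, y} ∅) = #(F.filter (fun X => x ∉ X ∧ y ∉ X)) := by
  rw [hx_card_tr]; congr 1; ext X
  simp only [mem_filter, ← disjoint_iff_inter_eq_empty, disjoint_insert_right,
    disjoint_singleton_right]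

lemma hxS_bar {i j x : ℕ} (F : Finset (Finset ℕ)) (hxi : x ≠ i) :
    #(hxTr F {x} ∅) ≤ #(hxTr (hxS i j F) {x} ∅) := by
  rw [hx_tr1, hx_tr1]
  apply card_le_card_of_injOn (hxphi i j F)
  · intro X hX
    rw [mem_coe, mem_filter] at hX
    rw [mem_coe, mem_filter]
    refine ⟨mem_image_of_mem _ hX.1, ?_⟩
    rcases hxphi_cases (i := i) (j := j) hX.1 with ⟨h1, h2⟩ | ⟨h1, h2, h3, h4⟩
    · rw [h2]; exact hX.2
    · rw [h4, mem_insert, mem_erase]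
      rintro (rfl | h)
      · exact hxi rfl
      · exact hX.2 h.2
  · exact (hxphi_inj F).mono (filter_subset _ _)

lemma hxS_bar2 {i j x : ℕ} (F : Finset (Finset ℕ)) (hx : x = i ∨ x = j) :
    #(hxTr F {i, j} ∅) ≤ #(hxTr (hxS i j F) {x} ∅) := by
  rw [hx_tr1, hx_tr2]
  apply card_le_card
  intro X hX
  rw [mem_filter] at hX ⊢
  refine ⟨?_, ?_⟩
  · rw [hxS, mem_image]
    refine ⟨X, hX.1, ?_⟩
    rcases hxphi_cases (i := i) (j := j) hX.1 with ⟨h1, h2⟩ | ⟨h1, h2, h3, h4⟩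
    · exact h2
    · exact absurd h2 hX.2.2
  · rcases hx with rfl | rfl
    · exact hX.2.1
    · exact hX.2.2

lemma hxS_sum {i j : ℕ} (hij : i < j) {F : Finset (Finset ℕ)} {X : Finset ℕ} (hX : X ∈ F)
    (hn : hxc i j X ∉ F) :
    ∑ Z ∈ hxS i j F, ∑ z ∈ Z, z < ∑ Z ∈ F, ∑ z ∈ Z, z := by
  rw [hxS, sum_image (hxphi_inj F)]
  have hlt : ∀ Y, i ∉ Y → j ∈ Y → ∑ z ∈ insert i (Y.erase j), z < ∑ z ∈ Y, z := by
    intro Y h1 h2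
    rw [sum_insert (fun hh => h1 (mem_of_mem_erase hh)), ← add_sum_erase Y (fun z => z) h2]
    simpa using hij
  apply sum_lt_sum
  · intro Y hY
    rcases hxphi_cases (i := i) (j := j) hY with ⟨h1, h2⟩ | ⟨h1, h2, h3, h4⟩
    · rw [h2]
    · rw [h4]; exact (hlt Y h1 h2).le
  · refine ⟨X, hX, ?_⟩
    rcases hxphi_cases (i := i) (j := j) hX with ⟨h1, h2⟩ | ⟨h1, h2, h3, h4⟩
    · exact absurd h1 hn
    · rw [h4]; exact hlt X h1 h2

lemma hx_shifted {v c : ℕ} (h : c + 3 ≤ v) (S : ℕ) : ∀ F : Finset (Finset ℕ),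
    ∑ Z ∈ F, ∑ z ∈ Z, z ≤ S →
    F ⊆ powersetCard (c + 5) (Icc 1 (v + c + 8)) → Intersecting F →
    #(Jfam (v + c + 8) (c + 5) 3) < #F →
    (∀ x ∈ Icc 1 (v + c + 8), (v + c + 5).choose (c + 3) < #(hxTr F {x} ∅)) →
    ∃ G : Finset (Finset ℕ), G ⊆ powersetCard (c + 5) (Icc 1 (v + c + 8)) ∧ Intersecting G ∧
      #(Jfam (v + c + 8) (c + 5) 3) < #G ∧
      (∀ x ∈ Icc 1 (v + c + 8), (v + c + 5).choose (c + 3) < #(hxTr G {x} ∅)) ∧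
      (∀ i ∈ Icc 1 (v + c + 8), ∀ j ∈ Icc 1 (v + c + 8), i < j → ∀ X ∈ G, hxc i j X ∈ G) := by
  induction S with
  | zero =>
    intro F hS hF hint hJ hg
    refine ⟨F, hF, hint, hJ, hg, ?_⟩
    intro i _ j _ hij X hX
    by_contra hn
    have := hxS_sum hij hX hn
    omega
  | succ S ih =>
    intro F hS hF hint hJ hg
    by_cases hsh : ∀ i ∈ Icc 1 (v + c + 8), ∀ j ∈ Icc 1 (v + c + 8), i < j → ∀ X ∈ F, hxc i j X ∈ F
    · exact ⟨F, hF, hint, hJ, hg, hsh⟩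
    · push Not at hsh
      obtain ⟨i, hi, j, hj, hij, X, hX, hn⟩ := hsh
      have hlt := hxS_sum hij hX hn
      have hF' := hxS_sub (j := j) hi hF
      have hint' := hxS_int (i := i) (j := j) hint
      have hJ' : #(Jfam (v + c + 8) (c + 5) 3) < #(hxS i j F) := by rwa [hxS_card]
      refine ih (hxS i j F) (by omega) hF' hint' hJ' ?_
      intro x hx
      by_cases hxij : x = i ∨ x = j
      · have h1 := hxS_bar2 F hxij
        have h2 := hx_stepII h hF hint hJ hg hi hj hij.ne
        have h3 : (v + c + 4).choose 1 ≤ (v + c + 4).choose (c + 3) :=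
          hx_choose_mono (by omega) (by omega)
        rw [Nat.choose_one_right] at h3
        rcases hx_dich h hF' hint' hJ' hx with h4 | h4
        · omega
        · exact h4
      · push Not at hxij
        exact (hg x hx).trans_le (hxS_bar F hxij.1)
end

section
open Finset
open scoped FinsetFamily

lemma hx_walk {n k : ℕ} {F : Finset (Finset ℕ)} (hF : F ⊆ powersetCard k (Icc 1 n))
    (hint : Intersecting F)
    (hsh : ∀ i ∈ Icc 1 n, ∀ j ∈ Icc 1 n, i < j → ∀ X ∈ F, hxc i j X ∈ F)
    {X : Finset ℕ} (hX : X ∈ F) : ∃ i, i + 1 ≤ #(X ∩ Icc 1 (2 * i + 1)) := by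
  by_contra hcon
  push Not at hcon
  have hhalf : ∀ s, 2 * #(X ∩ Icc 1 (s + 1)) ≤ s + 1 := by
    intro s
    obtain ⟨i, rfl | rfl⟩ : ∃ i, s = 2 * i ∨ s = 2 * i + 1 := ⟨s / 2, by omega⟩
    · have := hcon i; omega
    · have := hcon i
      have h2 : #(X ∩ Icc 1 (2 * i + 1 + 1)) ≤ #(X ∩ Icc 1 (2 * i + 1)) + 1 := by
        have : X ∩ Icc 1 (2 * i + 1 + 1) ⊆ insert (2 * i + 2) (X ∩ Icc 1 (2 * i + 1)) := by
          intro z hz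
          simp only [mem_insert, mem_inter, mem_Icc] at hz ⊢
          by_cases hh : z = 2 * i + 2
          · exact Or.inl hh
          · exact Or.inr ⟨hz.1, by omega⟩
        exact (card_le_card this).trans (card_insert_le _ _)
      omega
  have hXk := mem_powersetCard.1 (hF hX)
  have key : ∀ s, s ≤ n → ∃ Y ∈ F, Y \ Icc 1 s = X \ Icc 1 s ∧ ∀ z ∈ Icc 1 s, z ∈ X → z ∉ Y := by
    intro s
    induction s with
    | zero => exact fun _ => ⟨X, hX, rfl, by simp⟩
    | succ s ih =>
      intro hs
      obtain ⟨Y, hY, hYX, hd⟩ := ih (by omega)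
      have hout : ∀ z, s < z → (z ∈ Y ↔ z ∈ X) := by
        intro z hz
        have := Finset.ext_iff.1 hYX z
        simp only [mem_sdiff, mem_Icc, not_and, not_le] at this
        constructor
        · intro h; exact (this.1 ⟨h, fun _ => hz⟩).1
        · intro h; exact (this.2 ⟨h, fun _ => hz⟩).1
      by_cases hsX : s + 1 ∈ X
      · have hYk := mem_powersetCard.1 (hF hY)
        have c1 := card_sdiff_add_card_inter X (Icc 1 s)
        have c2 := card_sdiff_add_card_inter Y (Icc 1 s)
        rw [hYX] at c2
        have c3 : #(X ∩ Icc 1 s) + 1 ≤ #(X ∩ Icc 1 (s + 1)) := by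
          rw [← card_insert_of_notMem (a := s + 1) (s := X ∩ Icc 1 s) (by simp)]
          apply card_le_card
          intro z hz
          simp only [mem_insert, mem_inter, mem_Icc] at hz ⊢
          rcases hz with rfl | hz
          · exact ⟨hsX, by omega⟩
          · exact ⟨hz.1, by omega⟩
        have c4 := hhalf s
        have : ∃ z ∈ Icc 1 s, z ∉ (X ∩ Icc 1 s) ∪ (Y ∩ Icc 1 s) := by
          apply exists_mem_notMem_of_card_lt_card
          have := card_union_le (X ∩ Icc 1 s) (Y ∩ Icc 1 s)
          rw [Nat.card_Icc]; omega
        obtain ⟨z, hz, hzn⟩ := this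
        have hzX : z ∉ X := fun hh => hzn (mem_union_left _ (mem_inter.2 ⟨hh, hz⟩))
        have hzY : z ∉ Y := fun hh => hzn (mem_union_right _ (mem_inter.2 ⟨hh, hz⟩))
        rw [mem_Icc] at hz
        have hsY : s + 1 ∈ Y := (hout _ (by omega)).2 hsX
        have hY' := hsh z (by rw [mem_Icc]; omega) (s + 1) (by rw [mem_Icc]; omega) (by omega) Y hY
        rw [hxc, if_pos ⟨hzY, hsY⟩] at hY'
        refine ⟨_, hY', ?_, ?_⟩
        · ext u
          simp only [mem_sdiff, mem_insert, mem_erase, mem_Icc, not_and, not_le]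
          constructor
          · rintro ⟨rfl | hu, hu2⟩
            · have := hu2 hz.1; omega
            · have hus : s < u := by
                by_contra hh
                rcases Nat.eq_zero_or_pos u with rfl | hpos
                · have := (mem_Icc.1 (hYk.1 hu.2)).1; omega
                · have := hu2 hpos; omega
              exact ⟨(hout u hus).1 hu.2, hu2⟩
          · rintro ⟨hu, hu2⟩
            have hu1 := (mem_Icc.1 (hXk.1 hu)).1
            have := hu2 hu1
            exact ⟨Or.inr ⟨by omega, (hout u (by omega)).2 hu⟩, hu2⟩
        · intro u hu huX huY
          rw [mem_insert, mem_erase] at huY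
          rw [mem_Icc] at hu
          rcases huY with rfl | ⟨h1, h2⟩
          · exact hzX huX
          · exact hd u (by rw [mem_Icc]; omega) huX h2
      · have hsY : s + 1 ∉ Y := fun hh => hsX ((hout _ (by omega)).1 hh)
        refine ⟨Y, hY, ?_, ?_⟩
        · ext u
          simp only [mem_sdiff, mem_Icc, not_and, not_le]
          constructor
          · rintro ⟨hu, hu2⟩
            have hu1 := (mem_Icc.1 ((mem_powersetCard.1 (hF hY)).1 hu)).1
            have := hu2 hu1
            exact ⟨(hout u (by omega)).1 hu, hu2⟩
          · rintro ⟨hu, hu2⟩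
            have hu1 := (mem_Icc.1 (hXk.1 hu)).1
            have := hu2 hu1
            exact ⟨(hout u (by omega)).2 hu, hu2⟩
        · intro u hu huX huY
          rw [mem_Icc] at hu
          by_cases hus : u = s + 1
          · subst hus; exact hsX huX
          · exact hd u (by rw [mem_Icc]; omega) huX huY
  obtain ⟨Y, hY, -, hd⟩ := key n (le_refl n)
  obtain ⟨z, hz⟩ := hint X hX Y hY
  rw [mem_inter] at hz
  exact hd z (hXk.1 hz.1) hz.1 hz.2

lemma hx_fiber {P Q : Finset (Finset ℕ)} {p q : ℕ → Finset ℕ → Prop} {n A B : ℕ}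
    [∀ i, DecidablePred (p i)] [∀ i, DecidablePred (q i)]
    (h1 : ∀ X ∈ P, ∃ i < n, p i X) (h2 : ∀ i j Y, q i Y → q j Y → i = j)
    (h3 : ∀ i < n, #(P.filter (p i)) * A ≤ #(Q.filter (q i)) * B) : #P * A ≤ #Q * B := by
  have e1 : #P ≤ ∑ i ∈ range n, #(P.filter (p i)) := by
    refine (card_le_card ?_).trans card_biUnion_le
    intro X hX
    obtain ⟨i, hi, hp⟩ := h1 X hX
    exact mem_biUnion.2 ⟨i, mem_range.2 hi, mem_filter.2 ⟨hX, hp⟩⟩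
  have e2 : ∑ i ∈ range n, #(Q.filter (q i)) ≤ #Q := by
    rw [← card_biUnion]
    · apply card_le_card
      intro Y hY
      rw [mem_biUnion] at hY
      obtain ⟨i, -, hi⟩ := hY
      exact (mem_filter.1 hi).1
    · intro i _ j _ hij
      rw [Function.onFun]; rw [Finset.disjoint_left]
      intro Y h h'
      exact hij (h2 i j Y (mem_filter.1 h).2 (mem_filter.1 h').2)
  calc #P * A ≤ (∑ i ∈ range n, #(P.filter (p i))) * A := Nat.mul_le_mul_right _ e1
    _ = ∑ i ∈ range n, #(P.filter (p i)) * A := sum_mul _ _ _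
    _ ≤ ∑ i ∈ range n, #(Q.filter (q i)) * B :=
        sum_le_sum (fun i hi => h3 i (mem_range.1 hi))
    _ = (∑ i ∈ range n, #(Q.filter (q i))) * B := (sum_mul _ _ _).symm
    _ ≤ #Q * B := Nat.mul_le_mul_right _ e2

/-- The first `m` elements of `{4, 5, …}`. -/
def hxB (m : ℕ) : Finset ℕ := Icc 4 (m + 3)

lemma hxB_card (m : ℕ) : #(hxB m) = m := by rw [hxB, Nat.card_Icc]; omega

lemma hxB_mono {m m' : ℕ} (h : m ≤ m') : hxB m ⊆ hxB m' := Icc_subset_Icc (le_refl _) (by omega)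

lemma hxB_inter_le {m m' : ℕ} (h : m ≤ m') (X : Finset ℕ) :
    #(X ∩ hxB m') ≤ #(X ∩ hxB m) + (m' - m) := by
  have h1 : #(hxB m' \ hxB m) = m' - m := by
    rw [card_sdiff_of_subset (hxB_mono h), hxB_card, hxB_card]
  rw [← h1]
  refine (card_le_card ?_).trans (card_union_le _ _)
  intro z hz
  simp only [mem_union, mem_inter, mem_sdiff] at hz ⊢
  tauto
end

section
open Finset
open scoped FinsetFamily

lemma hx_W {M r t b : ℕ} (hbt : b + t = r + 1) (hM : r + b ≤ M)
    {P : Finset (Finset ℕ)} (hP : P ⊆ powersetCard r (hxB M))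
    (hw : ∀ X ∈ P, ∃ i, t + i ≤ #(X ∩ hxB (t + 2 * i))) :
    #P * (M - r) ≤ #(hxNb (hxB M) b P) * b := by
  classical
  apply hx_fiber (n := b)
    (p := fun i X => t + i ≤ #(X ∩ hxB (t + 2 * i)) ∧ ∀ j < i, #(X ∩ hxB (t + 2 * j)) < t + j)
    (q := fun i Y => #(Y ∩ hxB (t + 2 * i)) ≤ i ∧ ∀ j < i, j < #(Y ∩ hxB (t + 2 * j)))
  · intro X hX
    have hX' := mem_powersetCard.1 (hP hX)
    refine ⟨Nat.find (hw X hX), ?_, Nat.find_spec (hw X hX), ?_⟩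
    · have h1 := Nat.find_spec (hw X hX)
      have h2 := card_le_card (inter_subset_left (s₁ := X)
        (s₂ := hxB (t + 2 * Nat.find (hw X hX))))
      omega
    · intro j hj
      have := Nat.find_min (hw X hX) hj
      omega
  · rintro i j Y ⟨h1, h2⟩ ⟨g1, g2⟩
    rcases lt_trichotomy i j with h | h | h
    · have := g2 i h; omega
    · exact h
    · have := h2 j h; omega
  · intro i hi
    set S := hxB (t + 2 * i) with hS
    have hSc : #S = t + 2 * i := hxB_card _
    have hSU : S ⊆ hxB M := hxB_mono (by omega)
    set Pi := P.filter (fun X => t + i ≤ #(X ∩ S) ∧ ∀ j < i, #(X ∩ hxB (t + 2 * j)) < t + j)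
      with hPi
    set Ni := (hxNb (hxB M) b P).filter
      (fun Y => #(Y ∩ S) ≤ i ∧ ∀ j < i, j < #(Y ∩ hxB (t + 2 * j))) with hNi
    have hPif : ∀ X ∈ Pi, X ⊆ hxB M ∧ #X = r ∧ #(X ∩ S) = t + i := by
      intro X hX
      rw [hPi, mem_filter] at hX
      obtain ⟨hX, h1, h2⟩ := hX
      have hX' := mem_powersetCard.1 (hP hX)
      refine ⟨hX'.1, hX'.2, ?_⟩
      rcases Nat.eq_zero_or_pos i with rfl | hpos
      · have := card_le_card (inter_subset_right (s₁ := X) (s₂ := S)); omega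
      · have g1 := h2 (i - 1) (by omega)
        have g2 := hxB_inter_le (show t + 2 * (i - 1) ≤ t + 2 * i by omega) X
        rw [← hS] at g2
        omega
    have hdc : #Pi * (M - r - i).choose (b - i) ≤ #Ni * (M - r - 1 - i).choose (b - 1 - i) := by
      apply card_mul_le_card_mul (fun X Y => Disjoint X Y ∧ S ⊆ X ∪ Y)
      · intro X hX
        obtain ⟨hXU, hXr, hXS⟩ := hPif X hX
        have hSX : #(S \ X) = i := by
          have := card_sdiff_add_card_inter S X
          rw [inter_comm] at this; omega
        have hun : #(X ∪ S) = r + i := by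
          have := card_union_add_card_inter X S; omega
        have hcc : #(hxB M \ (X ∪ S)) = M - r - i := by
          rw [card_sdiff_of_subset (union_subset hXU hSU), hxB_card]; omega
        rw [← hcc, ← card_powersetCard]
        apply card_le_card_of_injOn (fun Z => Z ∪ (S \ X))
        · intro Z hZ
          rw [mem_coe, mem_powersetCard, subset_sdiff, disjoint_union_right] at hZ
          obtain ⟨⟨hZU, hZX, hZS⟩, hZc⟩ := hZ
          have hYS : (Z ∪ (S \ X)) ∩ S = S \ X := by
            rw [union_inter_distrib_right, disjoint_iff_inter_eq_empty.1 hZS, empty_union]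
            exact inter_eq_left.2 sdiff_subset
          have hd : Disjoint X (Z ∪ (S \ X)) := disjoint_union_right.2 ⟨hZX.symm, disjoint_sdiff⟩
          rw [mem_coe, mem_bipartiteAbove]
          refine ⟨?_, hd, ?_⟩
          · rw [hNi, mem_filter, hx_mem_nb]
            refine ⟨⟨⟨union_subset hZU (sdiff_subset.trans hSU), ?_⟩, X, ?_, hd⟩, ?_, ?_⟩
            · rw [card_union_of_disjoint (disjoint_of_subset_right sdiff_subset hZS)]; omega
            · exact (mem_filter.1 hX).1
            · rw [hYS]; omega
            · intro j hj
              have hXj := (mem_filter.1 hX).2.2 j hj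
              have h1 : hxB (t + 2 * j) \ X ⊆ (Z ∪ (S \ X)) ∩ hxB (t + 2 * j) := by
                intro z hz
                rw [mem_sdiff] at hz
                rw [mem_inter, mem_union, mem_sdiff]
                exact ⟨Or.inr ⟨hxB_mono (by omega) hz.1, hz.2⟩, hz.1⟩
              have h2 := card_le_card h1
              have h3 := card_sdiff_add_card_inter (hxB (t + 2 * j)) X
              rw [inter_comm, hxB_card] at h3
              show j < #((Z ∪ (S \ X)) ∩ hxB (t + 2 * j))
              omega
          · intro z hz
            simp only [mem_union, mem_sdiff]
            tauto
        · intro Z hZ Z' hZ' e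
          have e : Z ∪ (S \ X) = Z' ∪ (S \ X) := e
          rw [mem_coe, mem_powersetCard, subset_sdiff, disjoint_union_right] at hZ hZ'
          have g : ∀ W : Finset ℕ, Disjoint W S → (W ∪ (S \ X)) \ S = W := by
            intro W hW
            rw [union_sdiff_distrib, sdiff_eq_self_of_disjoint hW,
              sdiff_eq_empty_iff_subset.2 sdiff_subset, union_empty]
          rw [← g Z hZ.1.2.2, e, g Z' hZ'.1.2.2]
      · intro Y hY
        rw [hNi, mem_filter, hx_mem_nb] at hY
        obtain ⟨⟨⟨hYU, hYb⟩, -⟩, hYS, -⟩ := hY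
        have hcc : #(hxB M \ (S ∪ Y)) ≤ M - r - 1 - i := by
          rw [card_sdiff_of_subset (union_subset hSU hYU), hxB_card]
          have := card_union_add_card_inter S Y
          rw [inter_comm] at this
          omega
        refine le_trans ?_ (Nat.choose_le_choose _ hcc)
        rw [← card_powersetCard]
        have hXS : ∀ X, Disjoint X Y → S ⊆ X ∪ Y → X = (X \ S) ∪ (S \ Y) := by
          intro X hd hs
          rw [Finset.disjoint_left] at hd
          ext z
          have := @hs z
          have := @hd z
          simp only [mem_union, mem_sdiff] at *
          tauto
        apply card_le_card_of_injOn (fun X => X \ S)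
        · intro X hX
          rw [mem_coe, mem_bipartiteBelow] at hX
          obtain ⟨hX, hd, -⟩ := hX
          obtain ⟨hXU, hXr, hXS⟩ := hPif X hX
          rw [mem_coe, mem_powersetCard]
          constructor
          · intro z hz
            rw [mem_sdiff] at hz
            rw [mem_sdiff, mem_union]
            refine ⟨hXU hz.1, ?_⟩
            rintro (h | h)
            · exact hz.2 h
            · exact Finset.disjoint_left.1 hd hz.1 h
          · have := card_sdiff_add_card_inter X S
            show #(X \ S) = b - 1 - i
            omega
        · intro X hX X' hX' e
          have e : X \ S = X' \ S := e
          rw [mem_coe, mem_bipartiteBelow] at hX hX'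
          rw [hXS X hX.2.1 hX.2.2, hXS X' hX'.2.1 hX'.2.2, e]
    obtain ⟨d, hd⟩ : ∃ d, b = i + d + 1 := ⟨b - i - 1, by omega⟩
    obtain ⟨m, hm⟩ : ∃ m, M = r + b + m := ⟨M - r - b, by omega⟩
    rw [show M - r - i = (d + m) + 1 by omega, show b - i = d + 1 by omega,
      show M - r - 1 - i = d + m by omega, show b - 1 - i = d by omega] at hdc
    have hch := Nat.add_one_mul_choose_eq (d + m) d
    have hpos : 0 < (d + m).choose d := Nat.choose_pos (by omega)
    have h4 : #Pi * (d + m + 1) ≤ #Ni * (d + 1) := by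
      apply Nat.le_of_mul_le_mul_right _ hpos
      calc #Pi * (d + m + 1) * (d + m).choose d = #Pi * ((d + m + 1) * (d + m).choose d) := by ring
        _ = #Pi * (d + m + 1).choose (d + 1) * (d + 1) := by rw [hch]; ring
        _ ≤ #Ni * (d + m).choose d * (d + 1) := Nat.mul_le_mul_right _ hdc
        _ = _ := by ring
    have h5 : #Pi * (M - r) ≤ #Ni * b := by
      rw [show M - r = i + d + 1 + m by omega, hd]
      apply Nat.le_of_mul_le_mul_right _ (show 0 < d + 1 by omega)
      calc #Pi * (i + d + 1 + m) * (d + 1) ≤ #Pi * (d + m + 1) * (i + d + 1) := by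
            rw [mul_assoc, mul_assoc]; apply Nat.mul_le_mul_left; nlinarith
        _ ≤ #Ni * (d + 1) * (i + d + 1) := Nat.mul_le_mul_right _ h4
        _ = _ := by ring
    exact h5

lemma hx_sh {M r : ℕ} {D E : Finset (Finset ℕ)} (hD : D ⊆ powersetCard r (hxB M))
    (hE : ∀ X ∈ D, ∀ z ∈ X, X.erase z ∈ E)
    (hw : ∀ X ∈ D, ∃ i, 4 + i ≤ #(X ∩ hxB (4 + 2 * i))) : #D ≤ #E := by
  classical
  have : #D * 1 ≤ #E * 1 := by
    apply hx_fiber (n := r)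
      (p := fun i X => 4 + i ≤ #(X ∩ hxB (4 + 2 * i)) ∧
        ∀ j, i < j → #(X ∩ hxB (4 + 2 * j)) < 4 + j)
      (q := fun i Y => 3 + i ≤ #(Y ∩ hxB (4 + 2 * i)) ∧
        ∀ j, i < j → #(Y ∩ hxB (4 + 2 * j)) < 3 + j)
    · intro X hX
      have hX' := mem_powersetCard.1 (hD hX)
      have hbd : ∀ i, 4 + i ≤ #(X ∩ hxB (4 + 2 * i)) → i < r := by
        intro i hi
        have := card_le_card (inter_subset_left (s₁ := X) (s₂ := hxB (4 + 2 * i)))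
        omega
      obtain ⟨i0, hi0⟩ := hw X hX
      have hg := Nat.findGreatest_spec (P := fun i => 4 + i ≤ #(X ∩ hxB (4 + 2 * i)))
        (hbd i0 hi0).le hi0
      refine ⟨_, hbd _ hg, hg, ?_⟩
      intro j hj
      by_contra hc
      push Not at hc
      have := Nat.le_findGreatest (P := fun i => 4 + i ≤ #(X ∩ hxB (4 + 2 * i)))
        (hbd j hc).le hc
      omega
    · rintro i j Y ⟨h1, h2⟩ ⟨g1, g2⟩
      rcases lt_trichotomy i j with h | h | h
      · have := h2 j h; omega
      · exact h
      · have := g2 i h; omega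
    · intro i hi
      set S := hxB (4 + 2 * i) with hS
      have hSc : #S = 4 + 2 * i := hxB_card _
      set Pi := D.filter (fun X => 4 + i ≤ #(X ∩ S) ∧ ∀ j, i < j → #(X ∩ hxB (4 + 2 * j)) < 4 + j)
        with hPi
      set Ni := E.filter
        (fun Y => 3 + i ≤ #(Y ∩ S) ∧ ∀ j, i < j → #(Y ∩ hxB (4 + 2 * j)) < 3 + j) with hNi
      have hdc : #Pi * (4 + i) ≤ #Ni * (i + 1) := by
        apply card_mul_le_card_mul (fun X Y => ∃ z ∈ X ∩ S, Y = X.erase z)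
        · intro X hX
          rw [hPi, mem_filter] at hX
          obtain ⟨hXD, h1, h2⟩ := hX
          refine h1.trans ?_
          apply card_le_card_of_injOn (fun z => X.erase z)
          · intro z hz
            rw [mem_coe] at hz
            have hz' := mem_inter.1 hz
            rw [mem_coe, mem_bipartiteAbove, hNi, mem_filter]
            refine ⟨⟨hE X hXD z hz'.1, ?_, ?_⟩, z, hz, rfl⟩
            · rw [erase_inter, card_erase_of_mem hz]; omega
            · intro j hj
              have hzj : z ∈ X ∩ hxB (4 + 2 * j) :=
                mem_inter.2 ⟨hz'.1, hxB_mono (by omega) hz'.2⟩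
              have := h2 j hj
              have hpos := card_pos.2 ⟨z, hzj⟩
              rw [erase_inter, card_erase_of_mem hzj]; omega
          · intro z hz z' hz' e
            have e : X.erase z = X.erase z' := e
            rw [mem_coe, mem_inter] at hz hz'
            by_contra hne
            have : z ∈ X.erase z' := mem_erase.2 ⟨hne, hz.1⟩
            rw [← e] at this
            exact notMem_erase z X this
        · intro Y hY
          rw [hNi, mem_filter] at hY
          obtain ⟨hYE, h1, h2⟩ := hY
          have hcc : #(S \ Y) ≤ i + 1 := by
            have := card_sdiff_add_card_inter S Y
            rw [inter_comm] at this; omega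
          refine le_trans ?_ hcc
          refine le_trans (card_le_card ?_) (card_image_le (f := fun z => insert z Y))
          intro X hX
          rw [mem_bipartiteBelow] at hX
          obtain ⟨-, z, hz, rfl⟩ := hX
          rw [mem_inter] at hz
          rw [mem_image]
          exact ⟨z, mem_sdiff.2 ⟨hz.2, notMem_erase _ _⟩, insert_erase hz.1⟩
      have : #Pi * 1 ≤ #Ni * 1 := by
        apply Nat.le_of_mul_le_mul_right _ (show 0 < 4 + i by omega)
        calc #Pi * 1 * (4 + i) = #Pi * (4 + i) := by ring
          _ ≤ #Ni * (i + 1) := hdc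
          _ ≤ #Ni * (4 + i) := Nat.mul_le_mul_left _ (by omega)
          _ = _ := by ring
      exact this
  omega
end

section
open Finset
open scoped FinsetFamily

lemma hx_arith1 {v c C f1 f2 f3 d : ℕ} (h : c + 3 ≤ v)
    (h6 : (c + 4) * (f1 + f2) ≤ (v + c + 5) * C) (h4 : f3 ≤ f2) (h5 : d ≤ f3) (h7 : C ≤ f3 + d) :
    (c + 3) * f1 ≤ (f2 + (f3 + d)) * (v + 2) := by
  have a1 : (v + c + 5) * C ≤ (v + c + 5) * (2 * f2) := Nat.mul_le_mul_left _ (by omega)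
  have a2 : (v + 2) * C ≤ (v + 2) * (f3 + d) := Nat.mul_le_mul_left _ h7
  have a3 : (v + c + 5) * C ≤ (2 * v + 4) * C := Nat.mul_le_mul_right _ (by omega)
  nlinarith

lemma hx_arith2 {e c f1 f2 f3 d n0 n1 n2 n3 : ℕ}
    (h1 : f1 * (c + 4) ≤ n1 * (c + 4 + e)) (h2 : f2 * (c + 3 + e) ≤ n2 * (c + 3))
    (h3 : f3 * (c + 3 + e) ≤ n3 * (c + 3)) (h0 : d * (c + 2 + e) ≤ n0 * (c + 2))
    (ha : (c + 3) * f1 ≤ (f2 + (f3 + d)) * (c + 4 + e)) :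
    f1 + f2 + f3 + d ≤ n0 + n1 + n2 + n3 := by
  have hd : d ≤ n0 := by
    apply Nat.le_of_mul_le_mul_right _ (show 0 < c + 2 by omega)
    nlinarith
  zify at *
  have g0 : (d : ℤ) * (c + 3 + e) ≤ n0 * (c + 3) := by nlinarith
  have g : (f2 + f3 + d : ℤ) * e ≤ (n0 + n2 + n3 - d - f2 - f3) * (c + 3) := by nlinarith
  have g2 : (f1 - n1 : ℤ) * (c + 4 + e) ≤ f1 * e := by nlinarith
  have g3 : (f1 - n1 : ℤ) * ((c + 3) * (c + 4 + e)) ≤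
      (n0 + n2 + n3 - d - f2 - f3) * ((c + 3) * (c + 4 + e)) := by
    calc (f1 - n1 : ℤ) * ((c + 3) * (c + 4 + e)) = (c + 3) * ((f1 - n1 : ℤ) * (c + 4 + e)) := by ring
      _ ≤ (c + 3) * (f1 * e) := mul_le_mul_of_nonneg_left g2 (by positivity)
      _ = ((c + 3) * f1) * e := by ring
      _ ≤ ((f2 + (f3 + d)) * (c + 4 + e)) * e := mul_le_mul_of_nonneg_right ha (by positivity)
      _ = ((f2 + f3 + d : ℤ) * e) * (c + 4 + e) := by ring
      _ ≤ ((n0 + n2 + n3 - d - f2 - f3) * (c + 3)) * (c + 4 + e) :=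
        mul_le_mul_of_nonneg_right g (by positivity)
      _ = _ := by ring
  have g4 := le_of_mul_le_mul_right g3 (by positivity)
  linarith

lemma hx_inter_card {X : Finset ℕ} {n : ℕ} (hX : X ⊆ Icc 1 n) (m : ℕ) :
    #(X ∩ Icc 1 (m + 3)) ≤ #(X ∩ {1, 2, 3}) + #((X \ {1, 2, 3}) ∩ hxB m) := by
  refine (card_le_card ?_).trans (card_union_le _ _)
  intro z hz
  rw [mem_inter, mem_Icc] at hz
  simp only [mem_union, mem_inter, mem_insert, mem_singleton, mem_sdiff, hxB, mem_Icc]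
  by_cases h : z = 1 ∨ z = 2 ∨ z = 3
  · exact Or.inl ⟨hz.1, h⟩
  · exact Or.inr ⟨⟨hz.1, h⟩, by omega⟩

lemma hx_sh32 {X : Finset ℕ} (m1 : 1 ∉ X) (m2 : 2 ∉ X) (m3 : 3 ∈ X) :
    (insert 2 (X.erase 3)) ∩ {1, 2, 3} = {2} ∧
      (insert 2 (X.erase 3)) \ {1, 2, 3} = X \ {1, 2, 3} := by
  constructor
  · ext u
    simp only [mem_inter, mem_insert, mem_erase, mem_singleton]
    grind
  · ext u
    simp only [mem_sdiff, mem_insert, mem_erase, mem_singleton]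
    grind

lemma hx_shz {X : Finset ℕ} {z : ℕ} (m1 : 1 ∉ X) (m2 : 2 ∉ X) (m3 : 3 ∉ X) (hz : 4 ≤ z) :
    (insert 3 (X.erase z)) ∩ {1, 2, 3} = {3} ∧
      (insert 3 (X.erase z)) \ {1, 2, 3} = (X \ {1, 2, 3}).erase z := by
  constructor
  · ext u
    simp only [mem_inter, mem_insert, mem_erase, mem_singleton]
    grind
  · ext u
    simp only [mem_sdiff, mem_insert, mem_erase, mem_singleton]
    grind

lemma hx_int3 {X : Finset ℕ} (m1 : 1 ∉ X) (m2 : 2 ∉ X) (m3 : 3 ∈ X) :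
    X ∩ {1, 2, 3} = {3} := by
  ext u
  simp only [mem_inter, mem_insert, mem_singleton]
  grind

set_option maxHeartbeats 1000000 in
lemma hx_stepIII {v c : ℕ} (h : c + 3 ≤ v) {F : Finset (Finset ℕ)}
    (hF : F ⊆ powersetCard (c + 5) (Icc 1 (v + c + 8))) (hint : Intersecting F)
    (hsh : ∀ i ∈ Icc 1 (v + c + 8), ∀ j ∈ Icc 1 (v + c + 8), i < j → ∀ X ∈ F, hxc i j X ∈ F)
    (hp : (v + c + 4).choose (c + 3) < #(hxTr F {1, 2} ∅)) :
    #F ≤ 3 * (v + c + 5).choose (c + 3) + (v + c + 5).choose (c + 2) := by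
  set T : Finset ℕ := {1, 2, 3} with hT
  set M := v + c + 5 with hM
  have hU : Icc 1 (v + c + 8) \ T = hxB M := by
    ext z
    simp only [hT, mem_sdiff, mem_Icc, mem_insert, mem_singleton, hxB]
    omega
  have hsub : ∀ S, hxTr F T S ⊆ powersetCard (c + 5 - #S) (hxB M) := by
    intro S; rw [← hU]; exact hx_tr_sub hF T S
  have s0 : hxTr F T ∅ ⊆ powersetCard (c + 5) (hxB M) := by simpa using hsub ∅
  have s1 : hxTr F T {1} ⊆ powersetCard (c + 4) (hxB M) := by simpa using hsub {1}
  have s2 : hxTr F T {2} ⊆ powersetCard (c + 4) (hxB M) := by simpa using hsub {2}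
  have s3 : hxTr F T {3} ⊆ powersetCard (c + 4) (hxB M) := by simpa using hsub {3}
  have s12 : hxTr F T {1, 2} ⊆ powersetCard (c + 3) (hxB M) := by simpa using hsub {1, 2}
  have s13 : hxTr F T {1, 3} ⊆ powersetCard (c + 3) (hxB M) := by simpa using hsub {1, 3}
  have s23 : hxTr F T {2, 3} ⊆ powersetCard (c + 3) (hxB M) := by simpa using hsub {2, 3}
  have s123 : hxTr F T {1, 2, 3} ⊆ powersetCard (c + 2) (hxB M) := by
    simpa using hsub {1, 2, 3}
  have c0 := hx_cross s123 (hx_tr_cross hint (T := T) (S := ∅) (S' := {1, 2, 3}) (by simp))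
  have c1 := hx_cross s23 (hx_tr_cross hint (T := T) (S := {1}) (S' := {2, 3}) (by simp))
  have c2 := hx_cross s13 (hx_tr_cross hint (T := T) (S := {2}) (S' := {1, 3}) (by simp))
  have c3 := hx_cross s12 (hx_tr_cross hint (T := T) (S := {3}) (S' := {1, 2}) (by simp))
  have c12 := hx_cross s2 (hx_tr_cross hint (T := T) (S := {1}) (S' := {2}) (by simp))
  rw [hxB_card] at c0 c1 c2 c3 c12
  -- walk properties
  have w2 : ∀ S : Finset ℕ, #S ≤ 1 → 1 ∉ S → ∀ X ∈ hxTr F T S, ∃ i, 2 + i ≤ #(X ∩ hxB (2 + 2 * i)) := by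
    intro S hS h1 Y hY
    rw [hx_mem_tr] at hY
    obtain ⟨X, hX, hXS, rfl⟩ := hY
    have hX' := mem_powersetCard.1 (hF hX)
    obtain ⟨i, hi⟩ := hx_walk hF hint hsh hX
    rcases i with _ | i
    · exfalso
      obtain ⟨z, hz⟩ := card_pos.1 (show 0 < #(X ∩ Icc 1 (2 * 0 + 1)) by omega)
      rw [mem_inter, mem_Icc] at hz
      obtain rfl : z = 1 := by omega
      exact h1 (hXS ▸ mem_inter.2 ⟨hz.1, by simp [hT]⟩)
    · have g := hx_inter_card hX'.1 (2 * i)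
      rw [show 2 * (i + 1) + 1 = 2 * i + 3 by ring] at hi
      rw [← hT, hXS] at g
      rcases i with _ | i
      · have : #((X \ T) ∩ hxB (2 * 0)) ≤ 0 := by
          refine (card_le_card inter_subset_right).trans ?_
          rw [hxB_card]
        omega
      · refine ⟨i, ?_⟩
        rw [show 2 * (i + 1) = 2 + 2 * i by ring] at g hi
        omega
  have w4 : ∀ X ∈ hxTr F T ∅, ∃ i, 4 + i ≤ #(X ∩ hxB (4 + 2 * i)) := by
    intro Y hY
    rw [hx_mem_tr] at hY
    obtain ⟨X, hX, hXS, rfl⟩ := hY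
    have hX' := mem_powersetCard.1 (hF hX)
    obtain ⟨i, hi⟩ := hx_walk hF hint hsh hX
    rcases i with _ | i
    · exfalso
      obtain ⟨z, hz⟩ := card_pos.1 (show 0 < #(X ∩ Icc 1 (2 * 0 + 1)) by omega)
      rw [mem_inter, mem_Icc] at hz
      obtain rfl : z = 1 := by omega
      have : 1 ∈ X ∩ T := mem_inter.2 ⟨hz.1, by simp [hT]⟩
      rw [hXS] at this
      exact notMem_empty _ this
    · have g := hx_inter_card hX'.1 (2 * i)
      rw [show 2 * (i + 1) + 1 = 2 * i + 3 by ring] at hi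
      rw [← hT, hXS, card_empty] at g
      have g2 : #((X \ T) ∩ hxB (2 * i)) ≤ 2 * i := by
        refine (card_le_card inter_subset_right).trans ?_
        rw [hxB_card]
      obtain ⟨i', rfl⟩ : ∃ i', i = i' + 2 := ⟨i - 2, by omega⟩
      refine ⟨i', ?_⟩
      rw [show 2 * (i' + 2) = 4 + 2 * i' by ring] at g hi
      omega
  have k1 := hx_kneser (b := c + 3) s1
  have k12 := hx_kneser (b := c + 4) s1
  have W2 := hx_W (t := 2) (b := c + 3) (by omega) (by omega) s2 (w2 {2} (by simp) (by simp))
  have W3 := hx_W (t := 2) (b := c + 3) (by omega) (by omega) s3 (w2 {3} (by simp) (by simp))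
  have W0 := hx_W (t := 4) (b := c + 2) (by omega) (by omega) s0 w4
  rw [hxB_card] at k1 k12
  rw [show M - (c + 4) = v + 1 by omega] at k1 k12 W2 W3
  rw [show M - (c + 3) = v + 2 by omega] at k1
  rw [show M - (c + 5) = v by omega] at W0
  -- shifts
  have f32 : #(hxTr F T {3}) ≤ #(hxTr F T {2}) := by
    apply card_le_card
    intro Y hY
    rw [hx_mem_tr] at hY ⊢
    obtain ⟨X, hX, hXS, rfl⟩ := hY
    have m3 : 3 ∈ X := by
      have : 3 ∈ X ∩ T := by rw [hXS]; simp
      exact (mem_inter.1 this).1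
    have m2 : 2 ∉ X := by
      intro h2
      have : 2 ∈ X ∩ T := mem_inter.2 ⟨h2, by simp [hT]⟩
      rw [hXS] at this; simp at this
    have m1 : 1 ∉ X := by
      intro h2
      have : 1 ∈ X ∩ T := mem_inter.2 ⟨h2, by simp [hT]⟩
      rw [hXS] at this; simp at this
    have := hsh 2 (by rw [mem_Icc]; omega) 3 (by rw [mem_Icc]; omega) (by omega) X hX
    rw [hxc, if_pos ⟨m2, m3⟩] at this
    have g := hx_sh32 m1 m2 m3
    rw [← hT] at g
    exact ⟨_, this, g.1, g.2⟩
  have fd3 : #(hxTr F T ∅) ≤ #(hxTr F T {3}) := by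
    apply hx_sh s0 _ w4
    intro Y hY z hz
    have hzB := (mem_powersetCard.1 (s0 hY)).1 hz
    rw [hxB, mem_Icc] at hzB
    rw [hx_mem_tr] at hY ⊢
    obtain ⟨X, hX, hXS, rfl⟩ := hY
    have hXn : ∀ u ∈ T, u ∉ X := by
      intro u hu huX
      have : u ∈ X ∩ T := mem_inter.2 ⟨huX, hu⟩
      rw [hXS] at this; exact notMem_empty _ this
    have m1 := hXn 1 (by simp [hT])
    have m2 := hXn 2 (by simp [hT])
    have m3 := hXn 3 (by simp [hT])
    have := hsh 3 (by rw [mem_Icc]; omega) z (by rw [mem_Icc]; omega) (by omega) X hX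
    rw [hxc, if_pos ⟨m3, (mem_sdiff.1 hz).1⟩] at this
    have g := hx_shz m1 m2 m3 (z := z) (by omega)
    rw [← hT] at g
    exact ⟨_, this, g.1, g.2⟩
  have h7 : (v + c + 4).choose (c + 3) ≤ #(hxTr F T {3}) + #(hxTr F T ∅) := by
    refine hp.le.trans ?_
    rw [hx_tr2, hx_card_tr, hx_card_tr]
    refine (card_le_card ?_).trans (card_union_le _ _)
    intro X hX
    rw [mem_filter] at hX
    obtain ⟨hX, m1, m2⟩ := hX
    rw [mem_union, mem_filter, mem_filter]
    by_cases m3 : 3 ∈ X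
    · left
      refine ⟨hX, ?_⟩
      rw [hT]
      exact hx_int3 m1 m2 m3
    · right
      refine ⟨hX, ?_⟩
      rw [← disjoint_iff_inter_eq_empty, hT]
      simp only [disjoint_insert_right, disjoint_singleton_right]
      exact ⟨m1, m2, m3⟩
  -- binomials
  have K1 : #(hxTr F T {1}) * (c + 4) ≤ #(hxNb (hxB M) (c + 3) (hxTr F T {1})) * (v + 2) := by
    have hpos : 0 < (v + 1).choose (c + 3) := Nat.choose_pos (by omega)
    have hch : (v + 2) * (v + 1).choose (c + 3) = (v + 2).choose (c + 4) * (c + 4) :=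
      Nat.add_one_mul_choose_eq (v + 1) (c + 3)
    apply Nat.le_of_mul_le_mul_right _ hpos
    calc _ = #(hxTr F T {1}) * (v + 1).choose (c + 3) * (c + 4) := by ring
      _ ≤ #(hxNb (hxB M) (c + 3) (hxTr F T {1})) * (v + 2).choose (c + 4) * (c + 4) :=
        Nat.mul_le_mul_right _ k1
      _ = #(hxNb (hxB M) (c + 3) (hxTr F T {1})) * ((v + 2) * (v + 1).choose (c + 3)) := by
        rw [hch]; ring
      _ = _ := by ring
  have K12 : #(hxTr F T {1}) + #(hxTr F T {2}) ≤ M.choose (c + 4) := by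
    have hpos : 0 < (v + 1).choose (c + 4) := Nat.choose_pos (by omega)
    have := Nat.le_of_mul_le_mul_right k12 hpos
    omega
  have h6 : (c + 4) * (#(hxTr F T {1}) + #(hxTr F T {2})) ≤
      (v + c + 5) * (v + c + 4).choose (c + 3) := by
    have hch : (v + c + 5) * (v + c + 4).choose (c + 3) = (v + c + 5).choose (c + 4) * (c + 4) :=
      Nat.add_one_mul_choose_eq (v + c + 4) (c + 3)
    rw [hch, mul_comm]
    exact Nat.mul_le_mul_right _ K12
  have ha := hx_arith1 h h6 f32 fd3 h7
  obtain ⟨e, rfl⟩ : ∃ e, v = c + 2 + e := ⟨v - (c + 2), by omega⟩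
  have hfin := hx_arith2 (e := e) (c := c)
    (by rw [show c + 4 + e = c + 2 + e + 2 by ring]; exact K1)
    (by rw [show c + 3 + e = c + 2 + e + 1 by ring]; exact W2)
    (by rw [show c + 3 + e = c + 2 + e + 1 by ring]; exact W3) W0
    (by rw [show c + 4 + e = c + 2 + e + 2 by ring]; exact ha)
  have hsum := hx_tr_sum3 F
  rw [← hT] at hsum c0
  omega

lemma hx_main {v c : ℕ} (h : c + 3 ≤ v) {F : Finset (Finset ℕ)}
    (hF : F ⊆ powersetCard (c + 5) (Icc 1 (v + c + 8))) (hint : Intersecting F)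
    (hJ : #(Jfam (v + c + 8) (c + 5) 3) < #F) :
    ∃ x ∈ Icc 1 (v + c + 8), ∃ K ⊆ (Icc 1 (v + c + 8)).erase x,
      #K = c + 4 ∧ ∀ A ∈ F, x ∈ A ∨ K ⊆ A := by
  by_contra hcon
  have hg : ∀ x ∈ Icc 1 (v + c + 8), (v + c + 5).choose (c + 3) < #(hxTr F {x} ∅) := by
    intro x hx
    rcases hx_dich h hF hint hJ hx with h1 | h1
    · exact absurd ⟨x, hx, hx_small h hF hint hJ hx h1⟩ hcon
    · exact h1
  obtain ⟨G, hG, hGi, hGJ, hGg, hGs⟩ := hx_shifted h _ F (le_refl _) hF hint hJ hg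
  have h1 := hx_stepII h hG hGi hGJ hGg (i := 1) (j := 2) (by rw [mem_Icc]; omega)
    (by rw [mem_Icc]; omega) (by omega)
  have h2 := hx_stepIII h hG hGi hGs h1
  have h3 := hx_gJ h
  omega
end

theorem stmt10 (n k : ℕ) (hk : 10 ≤ 2 * k) (hn : 2 * k < n)
    (F : Finset (Finset ℕ)) (hF : F ⊆ Finset.powersetCard k (Finset.Icc 1 n))
    (hint : Intersecting F) (hcard : (Jfam n k 3).card < F.card) :
    ∃ i ∈ Finset.Icc 1 n, ∃ K : Finset ℕ,
      K ⊆ (Finset.Icc 1 n).erase i ∧ K.card = k - 1 ∧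
        ∀ A ∈ F, i ∈ A ∨ K ⊆ A := by
  obtain ⟨c, rfl⟩ : ∃ c, k = c + 5 := ⟨k - 5, by omega⟩
  obtain ⟨v, rfl⟩ : ∃ v, n = v + c + 8 := ⟨n - c - 8, by omega⟩
  obtain ⟨x, hx, K, hK, hKc, hA⟩ := hx_main (by omega) hF hint hcard
  exact ⟨x, hx, K, hK, by omega, hA⟩
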